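/- arXiv:2512.20930 — 2 statements merged into one kernel-verified Lean document; each statement's English description precedes it below -/
import Mathlib

section
/- Let P be a right LCM monoid, K a complex Hilbert space, V an isometry on K, and W an isometric Nica-covariant representation of P on K such that V W(p) = W(p) V for all p ∈ P. Let V × W denote the isometric representation of the product monoid ℕ × P (which is again a right LCM monoid) sending (n, p) to V^n W(p). Then V × W is Nica-covariant if and only if V and W doubly commute, i.e., V W(p) = W(p) V and V* W(p) = W(p) V* for all p ∈ P. -/
open ContinuousLinearMap

/-- The right ideal `pP = {p * x : x ∈ P}` of a monoid. -/
def rightSet {M : Type*} [Monoid M] (p : M) : Set M := Set.range fun x => p * x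

/-- A right LCM monoid: a left-cancellative monoid in which the intersection of two
principal right ideals is either empty or again a principal right ideal. -/
def IsRightLCMMonoid (M : Type*) [Monoid M] : Prop :=
  (∀ a b c : M, a * b = a * c → b = c) ∧
    ∀ p q : M, rightSet p ∩ rightSet q = ∅ ∨ ∃ r : M, rightSet p ∩ rightSet q = rightSet r

/-- Nica covariance for an (isometric) operator-valued map on a right LCM monoid. -/
def IsNicaCovariant {M : Type*} [Monoid M] {K : Type*} [NormedAddCommGroup K]
    [InnerProductSpace ℂ K] [CompleteSpace K] (W : M → (K →L[ℂ] K)) : Prop :=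
  ∀ p q : M,
    (rightSet p ∩ rightSet q = ∅ → W p * adjoint (W p) * (W q * adjoint (W q)) = 0) ∧
    ∀ r : M, rightSet p ∩ rightSet q = rightSet r →
      W p * adjoint (W p) * (W q * adjoint (W q)) = W r * adjoint (W r)

theorem mem_rightSet_prod {P : Type*} [Monoid P] (a b : Multiplicative ℕ × P) :
    b ∈ rightSet a ↔ a.1.toAdd ≤ b.1.toAdd ∧ b.2 ∈ rightSet a.2 := by
  constructor
  · rintro ⟨x, rfl⟩
    refine ⟨?_, x.2, rfl⟩
    simp
  · rintro ⟨h, x, hx⟩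
    refine ⟨(Multiplicative.ofAdd (b.1.toAdd - a.1.toAdd), x), ?_⟩
    refine Prod.ext ?_ hx
    apply Multiplicative.toAdd.injective
    simp only [Prod.fst_mul, toAdd_mul, toAdd_ofAdd]
    omega

theorem self_mem_rightSet {M : Type*} [Monoid M] (a : M) : a ∈ rightSet a := ⟨1, mul_one a⟩

theorem range_proj_mul {A : Type*} [Monoid A] [StarMul A] (v : A) (hv : star v * v = 1)
    (n m : ℕ) :
    v ^ n * star v ^ n * (v ^ m * star v ^ m) = v ^ max n m * star v ^ max n m := by
  have h1 : ∀ k : ℕ, star v ^ k * v ^ k = 1 := by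
    intro k
    induction k with
    | zero => simp
    | succ k ih =>
      rw [pow_succ, pow_succ', mul_assoc, ← mul_assoc (star v) v, hv, one_mul, ih]
  rcases le_total n m with h | h
  · obtain ⟨d, rfl⟩ := Nat.exists_eq_add_of_le h
    rw [max_eq_right h, pow_add v, mul_assoc (v ^ n) (star v ^ n), mul_assoc (v ^ n) (v ^ d),
      ← mul_assoc (star v ^ n) (v ^ n), h1, one_mul]
  · obtain ⟨d, rfl⟩ := Nat.exists_eq_add_of_le h
    rw [max_eq_left h, Nat.add_comm m d, pow_add (star v), mul_assoc (v ^ (d + m)),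
      mul_assoc (star v ^ d), ← mul_assoc (star v ^ m) (v ^ m), h1, one_mul]

theorem proj_mul_form {A : Type*} [Monoid A] [StarMul A] (v w : A) (h1 : Commute v w)
    (h2 : Commute (star v) w) (n : ℕ) :
    v ^ n * w * star (v ^ n * w) = v ^ n * star v ^ n * (w * star w) := by
  have h3 : Commute (star v ^ n) (w * star w) :=
    (h2.mul_right h1.star_star).pow_left n
  rw [star_mul, star_pow, ← mul_assoc, mul_assoc (v ^ n) w, mul_assoc (v ^ n), ← h3.eq, mul_assoc]

/-- Let `V` be an isometry commuting with an isometric Nica-covariant representation `W` of a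
right LCM monoid `P`.  The representation `V × W : (n, p) ↦ Vⁿ W(p)` of `ℕ × P` is
Nica-covariant if and only if `V` and `W` doubly commute. -/
theorem prod_nicaCovariant_iff_doublyCommute {P : Type*} [Monoid P] (hP : IsRightLCMMonoid P)
    {K : Type*} [NormedAddCommGroup K] [InnerProductSpace ℂ K] [CompleteSpace K]
    (V : K →L[ℂ] K) (hViso : adjoint V * V = 1)
    (W : P →* (K →L[ℂ] K)) (hWiso : ∀ p : P, adjoint (W p) * W p = 1)
    (hWnica : IsNicaCovariant fun p : P => W p)
    (hcomm : ∀ p : P, V * W p = W p * V) :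
    IsNicaCovariant
        (fun q : Multiplicative ℕ × P => V ^ (Multiplicative.toAdd q.1) * W q.2) ↔
      ∀ p : P, V * W p = W p * V ∧ adjoint V * W p = W p * adjoint V := by
  constructor
  · intro h p
    refine ⟨hcomm p, ?_⟩
    have key := (h (Multiplicative.ofAdd 1, 1) (1, p)).2 (Multiplicative.ofAdd 1, p) (by
      ext x
      rw [Set.mem_inter_iff, mem_rightSet_prod, mem_rightSet_prod, mem_rightSet_prod]
      have : x.2 ∈ rightSet (1 : P) := ⟨x.2, one_mul _⟩
      simp [this])
    simp only [toAdd_ofAdd, pow_one, map_one, mul_one, toAdd_one, pow_zero, one_mul,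
      ← star_eq_adjoint] at key hViso hWiso ⊢
    have hs : star (V * W p) = star V * star (W p) := by rw [hcomm p, star_mul]
    rw [hs] at key
    have key2 := congrArg (fun T => star V * T * W p) key
    calc star V * W p = (star V * V) * star V * W p * (star (W p) * W p) := by
          rw [hViso, hWiso, one_mul, mul_one]
      _ = star V * (V * star V * (W p * star (W p))) * W p := by simp only [mul_assoc]
      _ = star V * (V * W p * (star V * star (W p))) * W p := key2
      _ = (star V * V) * W p * star V * (star (W p) * W p) := by simp only [mul_assoc]
      _ = W p * star V := by rw [hViso, hWiso, one_mul, mul_one]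
  · intro h a b
    have hprod : ∀ a b : Multiplicative ℕ × P,
        V ^ a.1.toAdd * W a.2 * star (V ^ a.1.toAdd * W a.2) *
          (V ^ b.1.toAdd * W b.2 * star (V ^ b.1.toAdd * W b.2)) =
        V ^ max a.1.toAdd b.1.toAdd * star V ^ max a.1.toAdd b.1.toAdd *
          (W a.2 * star (W a.2) * (W b.2 * star (W b.2))) := by
      intro a b
      have c1 : ∀ p, Commute V (W p) := fun p => (h p).1
      have c2 : ∀ p, Commute (star V) (W p) := fun p => (h p).2
      rw [proj_mul_form _ _ (c1 _) (c2 _), proj_mul_form _ _ (c1 _) (c2 _),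
        ← range_proj_mul V hViso]
      have c3 : Commute (W a.2 * star (W a.2)) (V ^ b.1.toAdd * star V ^ b.1.toAdd) := by
        apply Commute.symm
        apply Commute.mul_left
        · apply Commute.pow_left
          refine (c1 _).mul_right ?_
          simpa using (c2 a.2).star_star
        · exact ((c2 _).mul_right (c1 _).star_star).pow_left _
      exact c3.mul_mul_mul_comm _ _
    simp only [← star_eq_adjoint]
    rw [hprod]
    refine ⟨fun he => ?_, fun r hr => ?_⟩
    · have : rightSet a.2 ∩ rightSet b.2 = ∅ := by
        rw [Set.eq_empty_iff_forall_notMem] at he ⊢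
        rintro x ⟨hx1, hx2⟩
        apply he (Multiplicative.ofAdd (max a.1.toAdd b.1.toAdd), x)
        rw [Set.mem_inter_iff, mem_rightSet_prod, mem_rightSet_prod]
        exact ⟨⟨le_max_left _ _, hx1⟩, ⟨le_max_right _ _, hx2⟩⟩
      have h0 := (hWnica a.2 b.2).1 this
      simp only [← star_eq_adjoint] at h0
      rw [h0, mul_zero]
    · have hm : ∀ x : Multiplicative ℕ × P, (a.1.toAdd ≤ x.1.toAdd ∧ x.2 ∈ rightSet a.2) ∧
          (b.1.toAdd ≤ x.1.toAdd ∧ x.2 ∈ rightSet b.2) ↔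
          (r.1.toAdd ≤ x.1.toAdd ∧ x.2 ∈ rightSet r.2) := by
        intro x
        rw [← mem_rightSet_prod, ← mem_rightSet_prod, ← mem_rightSet_prod, ← hr,
          Set.mem_inter_iff]
      have hr' := (hm r).2 ⟨le_rfl, self_mem_rightSet _⟩
      have hk : max a.1.toAdd b.1.toAdd = r.1.toAdd := by
        apply le_antisymm (max_le hr'.1.1 hr'.2.1)
        exact ((hm (Multiplicative.ofAdd (max a.1.toAdd b.1.toAdd), r.2)).1
          ⟨⟨le_max_left _ _, hr'.1.2⟩, ⟨le_max_right _ _, hr'.2.2⟩⟩).1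
      have hset : rightSet a.2 ∩ rightSet b.2 = rightSet r.2 := by
        ext x
        have := hm (r.1, x)
        simpa [hr'.1.1, hr'.2.1] using this
      have h0 := (hWnica a.2 b.2).2 _ hset
      simp only [← star_eq_adjoint] at h0
      rw [h0, hk, proj_mul_form _ _ (h _).1 (h _).2]
end

section
/- Let P be a right LCM monoid, H a complex Hilbert space, T a contractive representation of P on H, and S₁, S₂ contractions on H such that S₁S₂ = S₂S₁ and S_i T(p) = T(p) S_i for i = 1, 2 and all p ∈ P. Suppose that for each i = 1, 2 the representation S_i × T of ℕ × P (sending (n, p) to S_i^n T(p)) admits a *-regular dilation. Then there exist a Hilbert space L containing H as a closed subspace, commuting isometries V₁, V₂ on L, and an isometric Nica-covariant representation W of P on L such that: (1) V_i W(p) = W(p) V_i for i = 1, 2 and all p ∈ P; (2) P_H V₁^n V₂^m W(p)|_H = S₁^n S₂^m T(p) for all n, m ∈ ℕ and p ∈ P, i.e., (V₁ × V₂) × W is an isometric dilation of (S₁ × S₂) × T as representations of ℕ² × P; (3) for each i = 1, 2, the representation V_i × W of ℕ × P is an isometric Nica-covariant co-extension of S_i × T. -/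
open ContinuousLinearMap

set_option linter.unusedSimpArgs false

universe u

/-- The representation `S × T : (n, p) ↦ Sⁿ T(p)` of `ℕ × P` determined by an operator `S`
and an operator-valued map `T` on `P`. -/
def prodRepFun {P : Type*} [Monoid P] {H : Type*} [NormedAddCommGroup H] [Module ℂ H]
    (S : H →L[ℂ] H) (T : P → (H →L[ℂ] H)) :
    Multiplicative ℕ × P → (H →L[ℂ] H) :=
  fun q => S ^ (Multiplicative.toAdd q.1) * T q.2

/-- A representation `T` of a monoid `M` on `H` has a `*`-regular dilation if there exist a
Hilbert space `K ⊇ H` (realized via an isometric embedding `ι : H → K`) and an isometric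
representation `V` of `M` on `K` such that `P_H V(p)* V(q)|_H = T(a) T(b)*` whenever
`pM ∩ qM = rM` with `r = pa = qb`, and `P_H V(p)* V(q)|_H = 0` whenever `pM ∩ qM = ∅`. -/
def HasStarRegularDilation {M : Type*} [Monoid M] {H : Type u} [NormedAddCommGroup H]
    [InnerProductSpace ℂ H] [CompleteSpace H] (T : M → (H →L[ℂ] H)) : Prop :=
  ∃ (K : Type u) (_ : NormedAddCommGroup K) (_ : InnerProductSpace ℂ K) (_ : CompleteSpace K)
    (ι : H →ₗᵢ[ℂ] K) (V : M → (K →L[ℂ] K)),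
    V 1 = 1 ∧ (∀ a b : M, V (a * b) = V a * V b) ∧ (∀ x : M, adjoint (V x) * V x = 1) ∧
    ∀ p q : M,
      (rightSet p ∩ rightSet q = ∅ →
        adjoint ι.toContinuousLinearMap ∘L
          ((adjoint (V p) * V q) ∘L ι.toContinuousLinearMap) = 0) ∧
      ∀ r a b : M, rightSet p ∩ rightSet q = rightSet r → r = p * a → r = q * b →
        adjoint ι.toContinuousLinearMap ∘L
            ((adjoint (V p) * V q) ∘L ι.toContinuousLinearMap) = T a * adjoint (T b)

/-! ### Densely spanning families -/

theorem dil_ext_eq {I X K K' : Type*} [AddCommGroup X] [Module ℂ X]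
    [NormedAddCommGroup K] [InnerProductSpace ℂ K]
    [NormedAddCommGroup K'] [InnerProductSpace ℂ K']
    {e : I → X →ₗ[ℂ] K} (hd : DenseRange (Finsupp.lsum ℂ e))
    {A B : K →L[ℂ] K'} (h : ∀ i x, A (e i x) = B (e i x)) : A = B := by
  ext z
  refine hd.induction (P := fun z => A z = B z) ?_ (isClosed_eq A.continuous B.continuous) z
  rintro _ ⟨f, rfl⟩
  simp [Finsupp.lsum_apply, Finsupp.sum, map_sum, h]

theorem dil_ext_inner {I X K : Type*} [AddCommGroup X] [Module ℂ X]
    [NormedAddCommGroup K] [InnerProductSpace ℂ K]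
    {e : I → X →ₗ[ℂ] K} (hd : DenseRange (Finsupp.lsum ℂ e))
    {u v : K} (h : ∀ i x, inner ℂ u (e i x) = inner ℂ v (e i x)) : u = v := by
  have := dil_ext_eq hd (A := innerSL ℂ u) (B := innerSL ℂ v) (by simpa using h)
  have h2 : inner ℂ u (u - v) = inner ℂ v (u - v) := congrArg (fun f : K →L[ℂ] ℂ => f (u - v)) this
  rw [← sub_eq_zero, ← inner_sub_left, inner_self_eq_zero] at h2
  exact sub_eq_zero.1 h2

theorem dil_ext_adj {I X K : Type*} [AddCommGroup X] [Module ℂ X]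
    [NormedAddCommGroup K] [InnerProductSpace ℂ K] [CompleteSpace K]
    {e : I → X →ₗ[ℂ] K} (hd : DenseRange (Finsupp.lsum ℂ e))
    {A B : K →L[ℂ] K}
    (h : ∀ i x j y, inner ℂ (A (e i x)) (e j y) = inner ℂ (e i x) (B (e j y))) :
    adjoint A = B := by
  apply dil_ext_eq hd
  intro j y
  apply dil_ext_inner hd
  intro i x
  rw [adjoint_inner_left, ← inner_conj_symm, h i x j y, inner_conj_symm]

theorem dil_exists_ext {I X K K' : Type*} [AddCommGroup X] [Module ℂ X]
    [NormedAddCommGroup K] [InnerProductSpace ℂ K]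
    [NormedAddCommGroup K'] [InnerProductSpace ℂ K'] [CompleteSpace K']
    {e : I → X →ₗ[ℂ] K} (hd : DenseRange (Finsupp.lsum ℂ e))
    (ψ : I → X →ₗ[ℂ] K') (C : ℝ)
    (h : ∀ f, ‖Finsupp.lsum ℂ ψ f‖ ≤ C * ‖Finsupp.lsum ℂ e f‖) :
    ∃ A : K →L[ℂ] K', (∀ i x, A (e i x) = ψ i x) ∧ ∀ z, ‖A z‖ ≤ C * ‖z‖ := by
  refine ⟨(Finsupp.lsum ℂ ψ).extendOfNorm (Finsupp.lsum ℂ e), fun i x => ?_, fun z => ?_⟩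
  · have := LinearMap.extendOfNorm_eq hd ⟨C, h⟩ (Finsupp.single i x)
    simpa using this
  · exact LinearMap.norm_extendOfNorm_apply_le hd C h z

theorem dil_gram {I X K K' : Type*} [AddCommGroup X] [Module ℂ X]
    [NormedAddCommGroup K] [InnerProductSpace ℂ K]
    [NormedAddCommGroup K'] [InnerProductSpace ℂ K']
    {e : I → X →ₗ[ℂ] K} {ψ : I → X →ₗ[ℂ] K'}
    (h : ∀ i x j y, inner ℂ (ψ i x) (ψ j y) = inner ℂ (e i x) (e j y)) (f g : I →₀ X) :
    inner ℂ (Finsupp.lsum ℂ ψ f) (Finsupp.lsum ℂ ψ g) =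
      inner ℂ (Finsupp.lsum ℂ e f) (Finsupp.lsum ℂ e g) := by
  simp only [Finsupp.lsum_apply, Finsupp.sum, sum_inner, inner_sum, h]

theorem dil_gram_norm {I X K K' : Type*} [AddCommGroup X] [Module ℂ X]
    [NormedAddCommGroup K] [InnerProductSpace ℂ K]
    [NormedAddCommGroup K'] [InnerProductSpace ℂ K']
    {e : I → X →ₗ[ℂ] K} {ψ : I → X →ₗ[ℂ] K'}
    (h : ∀ i x j y, inner ℂ (ψ i x) (ψ j y) = inner ℂ (e i x) (e j y)) (f : I →₀ X) :
    ‖Finsupp.lsum ℂ ψ f‖ = ‖Finsupp.lsum ℂ e f‖ := by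
  rw [@norm_eq_sqrt_re_inner ℂ, @norm_eq_sqrt_re_inner ℂ _ _ _ _ (Finsupp.lsum ℂ e f),
    dil_gram h]

theorem dil_exists_isom {I X K : Type*} [AddCommGroup X] [Module ℂ X]
    [NormedAddCommGroup K] [InnerProductSpace ℂ K] [CompleteSpace K]
    {e : I → X →ₗ[ℂ] K} (hd : DenseRange (Finsupp.lsum ℂ e))
    (ψ : I → X →ₗ[ℂ] K)
    (h : ∀ i x j y, inner ℂ (ψ i x) (ψ j y) = inner ℂ (e i x) (e j y)) :
    ∃ A : K →L[ℂ] K, (∀ i x, A (e i x) = ψ i x) ∧ adjoint A * A = 1 := by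
  obtain ⟨A, hA, -⟩ := dil_exists_ext hd ψ 1 (fun f => by rw [dil_gram_norm h, one_mul])
  refine ⟨A, hA, ?_⟩
  apply dil_ext_eq hd
  intro i x
  apply dil_ext_inner hd
  intro j y
  change inner ℂ (adjoint A (A (e i x))) (e j y) = inner ℂ (e i x) (e j y)
  rw [adjoint_inner_left, hA, hA, h]

/-! ### Amplification -/

abbrev DilL2 (K : Type u) [NormedAddCommGroup K] : Type u := lp (fun _ : ℕ => K) 2

theorem dil_ampl (K : Type u) [NormedAddCommGroup K] [InnerProductSpace ℂ K] [CompleteSpace K] :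
    ∃ (L : Type u) (_ : NormedAddCommGroup L) (_ : InnerProductSpace ℂ L) (_ : CompleteSpace L)
      (E : ℕ → K →ₗ[ℂ] L) (π : (K →L[ℂ] K) →* (L →L[ℂ] L)),
      DenseRange (Finsupp.lsum ℂ E) ∧
      (∀ m x n y, inner ℂ (E m x) (E n y) = if m = n then inner ℂ x y else 0) ∧
      (∀ a n x, π a (E n x) = E n (a x)) ∧
      (∀ a, π (adjoint a) = adjoint (π a)) ∧ π 0 = 0 ∧ (∀ a b, π (a + b) = π a + π b) ∧
      (∀ a, ‖π a‖ ≤ ‖a‖) := by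
  classical
  let E : ℕ → K →ₗ[ℂ] DilL2 K := fun n => lp.lsingle (E := fun _ : ℕ => K) 2 n
  have hE : ∀ n x, E n x = lp.single 2 n x := fun n x => rfl
  have hin : ∀ m x n y, inner ℂ (E m x) (E n y) = if m = n then inner ℂ x y else 0 := by
    intro m x n y
    rw [hE, hE, lp.inner_single_left, lp.single_apply]
    split_ifs with h
    · subst h; simp
    · rw [Pi.single_eq_of_ne h]; simp
  have hd : DenseRange (Finsupp.lsum ℂ E) := by
    intro z
    have hs := lp.hasSum_single (p := 2) (by simp) z
    refine mem_closure_of_tendsto hs (Filter.Eventually.of_forall fun s => ?_)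
    refine ⟨∑ i ∈ s, Finsupp.single i (z i), ?_⟩
    rw [map_sum]
    simp [hE]
  have hn : ∀ f : ℕ →₀ K, ‖Finsupp.lsum ℂ E f‖ ^ 2 = ∑ i ∈ f.support, ‖f i‖ ^ 2 := by
    intro f
    rw [← @inner_self_eq_norm_sq ℂ]
    simp only [Finsupp.lsum_apply, Finsupp.sum, sum_inner, inner_sum, hin]
    rw [map_sum]
    refine Finset.sum_congr rfl fun i hi => ?_
    rw [Finset.sum_ite_eq' f.support i]
    simp only [hi, if_true]
    exact inner_self_eq_norm_sq _
  have hn' : ∀ (a : K →L[ℂ] K) (f : ℕ →₀ K),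
      ‖Finsupp.lsum ℂ (fun n => E n ∘ₗ (a : K →ₗ[ℂ] K)) f‖ ^ 2 =
        ∑ i ∈ f.support, ‖a (f i)‖ ^ 2 := by
    intro a f
    rw [← @inner_self_eq_norm_sq ℂ]
    simp only [Finsupp.lsum_apply, Finsupp.sum, sum_inner, inner_sum, hin, LinearMap.comp_apply]
    rw [map_sum]
    refine Finset.sum_congr rfl fun i hi => ?_
    rw [Finset.sum_ite_eq' f.support i]
    simp only [hi, if_true]
    exact inner_self_eq_norm_sq _
  have key : ∀ a : K →L[ℂ] K, ∃ A : DilL2 K →L[ℂ] DilL2 K, (∀ n x, A (E n x) = E n (a x)) ∧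
      ∀ z, ‖A z‖ ≤ ‖a‖ * ‖z‖ := by
    intro a
    refine dil_exists_ext hd (fun n => E n ∘ₗ (a : K →ₗ[ℂ] K)) ‖a‖ fun f => ?_
    refine le_of_sq_le_sq ?_ (by positivity)
    rw [mul_pow, hn, hn', Finset.mul_sum]
    refine Finset.sum_le_sum fun i _ => ?_
    rw [← mul_pow]
    exact pow_le_pow_left₀ (norm_nonneg _) (a.le_opNorm _) 2
  choose p hp hpn using key
  refine ⟨DilL2 K, inferInstance, inferInstance, inferInstance, E,
    ⟨⟨p, ?_⟩, ?_⟩, hd, hin, hp, ?_, ?_, ?_, ?_⟩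
  · exact dil_ext_eq hd fun n x => by simp [hp]
  · intro a b
    exact dil_ext_eq hd fun n x => by simp [hp]
  · intro a
    refine dil_ext_eq hd fun n x => dil_ext_inner hd fun m y => ?_
    change inner ℂ (p (adjoint a) (E n x)) (E m y) = inner ℂ (adjoint (p a) (E n x)) (E m y)
    rw [adjoint_inner_left, hp, hp, hin, hin, adjoint_inner_left]
  · refine dil_ext_eq hd fun n x => ?_
    change p 0 (E n x) = _
    rw [hp]; simp
  · intro a b
    refine dil_ext_eq hd fun n x => ?_
    change p (a + b) (E n x) = p a (E n x) + p b (E n x)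
    simp [hp]
  · intro a
    exact opNorm_le_bound _ (norm_nonneg _) (hpn a)
/-! ### Partial isometries, defect operators and the algebra behind Ando's theorem -/

theorem dil_partial {X : Type*} [NormedAddCommGroup X] [InnerProductSpace ℂ X] [CompleteSpace X]
    (A B : X →L[ℂ] X) (hAB : star A * A = star B * B) :
    ∃ u : X →L[ℂ] X, u * A = B ∧ star u * u * A = A ∧ u * star u * u = u ∧
      ∀ a : X →L[ℂ] X, a * A = A * a → star a * A = A * star a → a * B = B * a →
        a * u = u * a := by
  let M : Submodule ℂ X := (LinearMap.range (A : X →ₗ[ℂ] X)).topologicalClosure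
  have hM : IsClosed (M : Set X) := Submodule.isClosed_topologicalClosure _
  have : CompleteSpace M := hM.completeSpace_coe
  have hAM : ∀ x, A x ∈ M := fun x => Submodule.le_topologicalClosure _ ⟨x, rfl⟩
  let e : X →ₗ[ℂ] M := LinearMap.codRestrict M (A : X →ₗ[ℂ] X) hAM
  have he : ∀ x, ((e x : M) : X) = A x := fun x => rfl
  have hnorm : ∀ x y, inner ℂ (B x) (B y) = inner ℂ (A x) (A y) := by
    intro x y
    have := congrArg (fun f : X →L[ℂ] X => inner ℂ x (f y)) hAB
    simp only [star_eq_adjoint] at this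
    change inner ℂ x (adjoint A (A y)) = inner ℂ x (adjoint B (B y)) at this
    rw [adjoint_inner_right, adjoint_inner_right] at this
    exact this.symm
  have hd : DenseRange e := by
    intro z
    rw [Topology.IsInducing.subtypeVal.closure_eq_preimage_closure_image]
    have := z.2
    change (z : X) ∈ closure _ at this
    refine closure_mono ?_ this
    rintro _ ⟨x, rfl⟩
    exact ⟨e x, ⟨x, rfl⟩, rfl⟩
  have hb : ∀ x, ‖(B : X →ₗ[ℂ] X) x‖ ≤ 1 * ‖e x‖ := by
    intro x
    rw [one_mul]
    change ‖B x‖ ≤ ‖A x‖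
    rw [@norm_eq_sqrt_re_inner ℂ, @norm_eq_sqrt_re_inner ℂ _ _ _ _ (A x), hnorm]
  let v : M →L[ℂ] X := (B : X →ₗ[ℂ] X).extendOfNorm e
  have hv : ∀ x, v (e x) = B x := fun x => LinearMap.extendOfNorm_eq hd ⟨1, hb⟩ x
  have hvin : ∀ x (m : M), inner ℂ (v (e x)) (v m) = inner ℂ (e x) m := by
    intro x m
    refine hd.induction (P := fun m => inner ℂ (v (e x)) (v m) = inner ℂ (e x) m) ?_ ?_ m
    · rintro _ ⟨y, rfl⟩
      rw [hv, hv, hnorm]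
      rfl
    · exact isClosed_eq (by fun_prop) (by fun_prop)
  let u : X →L[ℂ] X := v ∘L M.orthogonalProjectionOnto
  have hu : ∀ x, u (A x) = B x := by
    intro x
    change v (M.orthogonalProjectionOnto (A x)) = _
    rw [← hv, ← he, Submodule.orthogonalProjectionOnto_mem_subspace_eq_self]
  have hu0 : ∀ y, adjoint A y = 0 → u y = 0 := by
    intro y hy
    have hy' : y ∈ Mᗮ := by
      rw [Submodule.orthogonal_closure, Submodule.mem_orthogonal]
      rintro _ ⟨x, rfl⟩
      change inner ℂ (A x) y = 0
      rw [← adjoint_inner_right, hy, inner_zero_right]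
    change v (M.orthogonalProjectionOnto y) = _
    rw [Submodule.orthogonalProjectionOnto_eq_zero_iff.2 hy', map_zero]
  have agree : ∀ f : X →L[ℂ] X, (∀ x, f (A x) = 0) → (∀ y, adjoint A y = 0 → f y = 0) →
      f = 0 := by
    intro f h1 h2
    ext x
    have hker : M ≤ LinearMap.ker (f : X →ₗ[ℂ] X) := by
      refine Submodule.topologicalClosure_minimal _ ?_ ?_
      · rintro _ ⟨x, rfl⟩
        exact h1 x
      · exact f.isClosed_ker
    have h3 : f (M.orthogonalProjectionOnto x : X) = 0 := hker (M.orthogonalProjectionOnto x).2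
    have h4 : adjoint A (x - M.orthogonalProjectionOnto x) = 0 := by
      refine ext_inner_left ℂ fun y => ?_
      rw [adjoint_inner_right, inner_zero_right]
      have := Submodule.sub_starProjection_mem_orthogonal (K := M) x
      exact (Submodule.mem_orthogonal _ _).1 this _ (hAM y)
    have h5 := h2 _ h4
    rw [map_sub, h3, sub_zero] at h5
    simpa using h5
  have huu : ∀ x, adjoint u (u (A x)) = A x := by
    intro x
    refine ext_inner_right ℂ fun y => ?_
    rw [adjoint_inner_left, hu, ← hv]
    change inner ℂ (v (e x)) (v (M.orthogonalProjectionOnto y)) = _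
    rw [hvin, ← he]
    exact Submodule.inner_orthogonalProjectionOnto_eq_of_mem_left (e x) y
  refine ⟨u, ?_, ?_, ?_, ?_⟩
  · ext x; exact hu x
  · ext x; exact huu x
  · rw [← sub_eq_zero]
    apply agree
    · intro x
      change u (adjoint u (u (A x))) - u (A x) = 0
      rw [huu, sub_self]
    · intro y hy
      change u (adjoint u (u y)) - u y = 0
      simp [hu0 y hy]
  · intro a h1 h2 h3
    rw [← sub_eq_zero]
    apply agree
    · intro x
      change a (u (A x)) - u (a (A x)) = 0
      have e1 : a (A x) = A (a x) := congrArg (fun f : X →L[ℂ] X => f x) h1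
      have e3 : a (B x) = B (a x) := congrArg (fun f : X →L[ℂ] X => f x) h3
      rw [e1, hu, hu, e3, sub_self]
    · intro y hy
      change a (u y) - u (a y) = 0
      have e2 := congrArg star h2
      rw [star_mul, star_mul, star_star] at e2
      have e4 : adjoint A (a y) = a (adjoint A y) := congrArg (fun f : X →L[ℂ] X => f y) e2
      rw [hu0 y hy, hu0 (a y) (by rw [e4, hy, map_zero]), map_zero, sub_self]

theorem dil_defect {X : Type*} [NormedAddCommGroup X] [InnerProductSpace ℂ X] [CompleteSpace X]
    (S : X →L[ℂ] X) (hS : ‖S‖ ≤ 1) :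
    ∃ D : X →L[ℂ] X, star S * S + star D * D = 1 ∧
      ∀ a : X →L[ℂ] X, a * S = S * a → star a * S = S * star a →
        a * D = D * a := by
  have h0 : 0 ≤ 1 - star S * S := by
    rw [sub_nonneg]
    have := CStarAlgebra.norm_le_one_iff_of_nonneg (star S * S) (star_mul_self_nonneg S)
    rw [← this, CStarRing.norm_star_mul_self]
    nlinarith [norm_nonneg S]
  refine ⟨CFC.sqrt (1 - star S * S), ?_, ?_⟩
  · have h1 : star (CFC.sqrt (1 - star S * S)) = CFC.sqrt (1 - star S * S) :=
      (CFC.sqrt_nonneg (1 - star S * S)).isSelfAdjoint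
    rw [h1, CFC.sqrt_mul_sqrt_self _ h0]
    abel
  · intro a h1 h2
    have h3 : a * star S = star S * a := by
      have := congrArg star h2
      simpa using this.symm
    have h4 : Commute (1 - star S * S) a := by
      refine (Commute.one_left a).sub_left ?_
      exact Commute.mul_left (show Commute (star S) a from h3.symm) (show Commute S a from h1.symm)
    exact (h4.cfcₙ_nnreal _).symm

theorem dil_halmos {A : Type*} [Ring A] [StarRing A] (R0 R1 u : A)
    (h00 : star R0 * R0 = 1) (h11 : star R1 * R1 = 1) (h01 : star R0 * R1 = 0)
    (h10 : star R1 * R0 = 0) (hs : R0 * star R0 + R1 * star R1 = 1)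
    (hu : u * star u * u = u) :
    ∃ U : A, star U * U = 1 ∧ U * star U = 1 ∧
      (∀ x, star u * u * x = x → U * (R0 * x) = R0 * (u * x)) ∧
      ∀ a, Commute a R0 → Commute (star a) R0 → Commute a R1 → Commute (star a) R1 →
        Commute a u → Commute (star a) u → Commute a U := by
  have k00 : ∀ x, star R0 * (R0 * x) = x := fun x => by rw [← mul_assoc, h00, one_mul]
  have k11 : ∀ x, star R1 * (R1 * x) = x := fun x => by rw [← mul_assoc, h11, one_mul]
  have k01 : ∀ x, star R0 * (R1 * x) = 0 := fun x => by rw [← mul_assoc, h01, zero_mul]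
  have k10 : ∀ x, star R1 * (R0 * x) = 0 := fun x => by rw [← mul_assoc, h10, zero_mul]
  have ku : ∀ x, u * (star u * (u * x)) = u * x := fun x => by
    rw [← mul_assoc, ← mul_assoc, hu]
  have hu' : star u * (u * star u) = star u := by
    have := congrArg star hu
    simpa [mul_assoc] using this
  have ku' : ∀ x, star u * (u * (star u * x)) = star u * x := fun x => by
    have := congrArg (· * x) hu'
    simpa [mul_assoc] using this
  refine ⟨R0 * u * star R0 + R0 * (1 - u * star u) * star R1 + R1 * (1 - star u * u) * star R0
    + R1 * star u * star R1, ?_, ?_, ?_, ?_⟩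
  · refine Eq.trans ?_ hs
    simp only [star_add, star_mul, star_sub, star_one, star_star, mul_add, add_mul, mul_sub,
      sub_mul, mul_assoc, k00, k11, k01, k10, ku, ku', mul_zero, one_mul, mul_one]
    abel
  · refine Eq.trans ?_ hs
    simp only [star_add, star_mul, star_sub, star_one, star_star, mul_add, add_mul, mul_sub,
      sub_mul, mul_assoc, k00, k11, k01, k10, ku, ku', mul_zero, one_mul, mul_one]
    abel
  · intro x hx
    rw [mul_assoc] at hx
    simp only [mul_add, add_mul, mul_sub,
      sub_mul, mul_assoc, k00, k11, k01, k10, mul_zero, one_mul, mul_one, hx]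
    abel
  · intro a h1 h2 h3 h4 h5 h6
    have st : ∀ {z}, Commute (star a) z → Commute a (star z) := fun h => by
      have := h.star_star
      rwa [star_star] at this
    have c1 := Commute.one_right a
    exact (((((h1.mul_right h5).mul_right (st h2)).add_right
      ((h1.mul_right (c1.sub_right (h5.mul_right (st h6)))).mul_right (st h4))).add_right
      ((h3.mul_right (c1.sub_right ((st h6).mul_right h5))).mul_right (st h2))).add_right
      ((h3.mul_right (st h6)).mul_right (st h4)))

theorem dil_alg {X : Type*} [NormedAddCommGroup X] [InnerProductSpace ℂ X] [CompleteSpace X]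
    (S1 S2 R0 R1 : X →L[ℂ] X) (hS1 : ‖S1‖ ≤ 1) (hS2 : ‖S2‖ ≤ 1) (hS : S1 * S2 = S2 * S1)
    (h00 : star R0 * R0 = 1) (h11 : star R1 * R1 = 1) (h01 : star R0 * R1 = 0)
    (h10 : star R1 * R0 = 0) (hs : R0 * star R0 + R1 * star R1 = 1) :
    ∃ U q d1 d2 : X →L[ℂ] X, star U * U = 1 ∧ U * star U = 1 ∧ q * q = 0 ∧
      star q * q + q * star q = 1 ∧
      star S1 * S1 + star d1 * d1 = 1 ∧ star S2 * S2 + star d2 * d2 = 1 ∧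
      star q * d1 = 0 ∧ star q * d2 = 0 ∧
      U * (d1 * S2 + q * d2) = d2 * S1 + q * d1 ∧
      ∀ a, Commute a R0 → Commute (star a) R0 → Commute a R1 → Commute (star a) R1 →
        Commute a S1 → Commute (star a) S1 → Commute a S2 → Commute (star a) S2 →
        Commute a U ∧ Commute a q ∧ Commute a d1 ∧ Commute a d2 := by
  obtain ⟨D1, hD1, cD1⟩ := dil_defect S1 hS1
  obtain ⟨D2, hD2, cD2⟩ := dil_defect S2 hS2
  have k00 : ∀ x, star R0 * (R0 * x) = x := fun x => by rw [← mul_assoc, h00, one_mul]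
  have k11 : ∀ x, star R1 * (R1 * x) = x := fun x => by rw [← mul_assoc, h11, one_mul]
  have k01 : ∀ x, star R0 * (R1 * x) = 0 := fun x => by rw [← mul_assoc, h01, zero_mul]
  have k10 : ∀ x, star R1 * (R0 * x) = 0 := fun x => by rw [← mul_assoc, h10, zero_mul]
  have g1 : star D1 * D1 = 1 - star S1 * S1 := by rw [← hD1]; abel
  have g2 : star D2 * D2 = 1 - star S2 * S2 := by rw [← hD2]; abel
  have g1' : ∀ x, star D1 * (D1 * x) = x - star S1 * (S1 * x) := fun x => by
    rw [← mul_assoc, g1, sub_mul, one_mul, mul_assoc]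
  have g2' : ∀ x, star D2 * (D2 * x) = x - star S2 * (S2 * x) := fun x => by
    rw [← mul_assoc, g2, sub_mul, one_mul, mul_assoc]
  have hS' : star S2 * star S1 = star S1 * star S2 := by rw [← star_mul, hS, star_mul]
  obtain ⟨u, hu1, hu2, hu3, hu4⟩ := dil_partial (R0 * D1 * S2 + R1 * D2) (R0 * D2 * S1 + R1 * D1)
    (by
      simp only [star_add, star_mul, mul_add, add_mul, mul_assoc, k00, k11, k01, k10, g1', g2',
        mul_zero, g1, g2, mul_sub, mul_one, hS]
      rw [← mul_assoc (star S2) (star S1), hS', mul_assoc]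
      abel)
  obtain ⟨U, hU1, hU2, hU3, hU4⟩ := dil_halmos R0 R1 u h00 h11 h01 h10 hs hu3
  refine ⟨U, R0 * R1 * star R0 * star R0 + R1 * R1 * star R0 * star R1, R0 * R0 * D1,
    R0 * R0 * D2, hU1, hU2, ?_, ?_, ?_, ?_, ?_, ?_, ?_, ?_⟩
  · simp only [mul_add, add_mul, mul_assoc, k00, k11, k01, k10, mul_zero, add_zero]
  · have e0 : R0 * star R0 = 1 - R1 * star R1 := by rw [← hs]; abel
    have e0' : ∀ x, R0 * (star R0 * x) = x - R1 * (star R1 * x) := fun x => by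
      rw [← mul_assoc, e0, sub_mul, one_mul, mul_assoc]
    simp only [star_add, star_mul, star_star, mul_add, add_mul, mul_assoc, k00, k11, k01, k10,
      mul_zero, add_zero, zero_add, e0', mul_sub]
    refine Eq.trans ?_ hs
    abel
  · simp only [star_mul, mul_assoc, k00, hD1]
  · simp only [star_mul, mul_assoc, k00, hD2]
  · simp only [star_add, star_mul, star_star, mul_add, add_mul, mul_assoc, k00, k11, k01, k10,
      mul_zero, add_zero]
  · simp only [star_add, star_mul, star_star, mul_add, add_mul, mul_assoc, k00, k11, k01, k10,
      mul_zero, add_zero]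
  · have := hU3 _ hu2
    rw [hu1] at this
    simp only [mul_add, add_mul, mul_assoc, k00, k11, k01, k10, mul_zero, add_zero] at this ⊢
    exact this
  · intro a h1 h2 h3 h4 h5 h6 h7 h8
    have st : ∀ {z}, Commute (star a) z → Commute a (star z) := fun h => by
      have := h.star_star
      rwa [star_star] at this
    have c1 : Commute a D1 := cD1 a h5 h6
    have c2 : Commute a D2 := cD2 a h7 h8
    have c1' : Commute (star a) D1 := cD1 (star a) h6 (by rw [star_star]; exact h5)
    have c2' : Commute (star a) D2 := cD2 (star a) h8 (by rw [star_star]; exact h7)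
    have cA : Commute a (R0 * D1 * S2 + R1 * D2) :=
      ((h1.mul_right c1).mul_right h7).add_right (h3.mul_right c2)
    have cA' : Commute (star a) (R0 * D1 * S2 + R1 * D2) :=
      ((h2.mul_right c1').mul_right h8).add_right (h4.mul_right c2')
    have cB : Commute a (R0 * D2 * S1 + R1 * D1) :=
      ((h1.mul_right c2).mul_right h5).add_right (h3.mul_right c1)
    have cB' : Commute (star a) (R0 * D2 * S1 + R1 * D1) :=
      ((h2.mul_right c2').mul_right h6).add_right (h4.mul_right c1')
    have cu : Commute a u := hu4 a cA cA' cB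
    have cu' : Commute (star a) u := hu4 (star a) cA' (by rw [star_star]; exact cA) cB'
    refine ⟨hU4 a h1 h2 h3 h4 cu cu', ?_, (h1.mul_right h1).mul_right c1,
      (h1.mul_right h1).mul_right c2⟩
    exact (((h1.mul_right h3).mul_right (st h2)).mul_right (st h2)).add_right
      (((h3.mul_right h3).mul_right (st h2)).mul_right (st h4))

/-- A Toeplitz-like isometry on `ℓ²(ℕ, X)`. -/
theorem dil_shift {X L : Type*} [NormedAddCommGroup X] [InnerProductSpace ℂ X] [CompleteSpace X]
    [NormedAddCommGroup L] [InnerProductSpace ℂ L] [CompleteSpace L]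
    (E : ℕ → X →ₗ[ℂ] L) (hd : DenseRange (Finsupp.lsum ℂ E))
    (hin : ∀ m x n y, inner ℂ (E m x) (E n y) = if m = n then inner ℂ x y else 0)
    (s d b c : X →L[ℂ] X) (h1 : star s * s + star d * d = 1) (h2 : star d * b = 0)
    (h3 : star b * b + star c * c = 1) (h4 : star c * b = 0) :
    ∃ V : L →L[ℂ] L, (∀ x, V (E 0 x) = E 0 (s x) + E 1 (d x)) ∧
      (∀ n x, V (E (n + 1) x) = E (n + 1) (b x) + E (n + 2) (c x)) ∧
      adjoint V * V = 1 ∧ ∀ x, adjoint V (E 0 x) = E 0 (adjoint s x) := by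
  let ψ : ℕ → X →ₗ[ℂ] L := fun n => Nat.casesOn n
    (E 0 ∘ₗ (s : X →ₗ[ℂ] X) + E 1 ∘ₗ (d : X →ₗ[ℂ] X))
    (fun n => E (n + 1) ∘ₗ (b : X →ₗ[ℂ] X) + E (n + 2) ∘ₗ (c : X →ₗ[ℂ] X))
  have p0 : ∀ x, ψ 0 x = E 0 (s x) + E 1 (d x) := fun x => rfl
  have p1 : ∀ n x, ψ (n + 1) x = E (n + 1) (b x) + E (n + 2) (c x) := fun n x => rfl
  have i1 : ∀ x y, inner ℂ (s x) (s y) + inner ℂ (d x) (d y) = inner ℂ x y := by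
    intro x y
    have := congrArg (fun f : X →L[ℂ] X => inner ℂ x (f y)) h1
    change inner ℂ x (adjoint s (s y) + adjoint d (d y)) = inner ℂ x y at this
    rwa [inner_add_right, adjoint_inner_right, adjoint_inner_right] at this
  have i3 : ∀ x y, inner ℂ (b x) (b y) + inner ℂ (c x) (c y) = inner ℂ x y := by
    intro x y
    have := congrArg (fun f : X →L[ℂ] X => inner ℂ x (f y)) h3
    change inner ℂ x (adjoint b (b y) + adjoint c (c y)) = inner ℂ x y at this
    rwa [inner_add_right, adjoint_inner_right, adjoint_inner_right] at this
  have i2 : ∀ x y, inner ℂ (d x) (b y) = 0 := by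
    intro x y
    have := congrArg (fun f : X →L[ℂ] X => inner ℂ x (f y)) h2
    change inner ℂ x (adjoint d (b y)) = inner ℂ x 0 at this
    rwa [adjoint_inner_right, inner_zero_right] at this
  have i4 : ∀ x y, inner ℂ (c x) (b y) = 0 := by
    intro x y
    have := congrArg (fun f : X →L[ℂ] X => inner ℂ x (f y)) h4
    change inner ℂ x (adjoint c (b y)) = inner ℂ x 0 at this
    rwa [adjoint_inner_right, inner_zero_right] at this
  have i2' : ∀ x y, inner ℂ (b x) (d y) = 0 := fun x y => inner_eq_zero_symm.1 (i2 y x)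
  have i4' : ∀ x y, inner ℂ (b x) (c y) = 0 := fun x y => inner_eq_zero_symm.1 (i4 y x)
  obtain ⟨V, hV, hVi⟩ := dil_exists_isom hd ψ (by
    intro m x n y
    rcases m with _ | m <;> rcases n with _ | n
    · simp only [p0, inner_add_left, inner_add_right, hin]
      simp [i1]
    · simp only [p0, p1, inner_add_left, inner_add_right, hin]
      rcases n with _ | n <;> simp [i2]
    · simp only [p0, p1, inner_add_left, inner_add_right, hin]
      rcases m with _ | n <;> simp [i2']
    · simp only [p1, inner_add_left, inner_add_right, hin]
      by_cases h : m = n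
      · subst h
        simp [i3]
      · by_cases h' : m = n + 1
        · subst h'
          simp [i4']
        · by_cases h'' : n = m + 1
          · subst h''
            simp [i4]
          · simp [h, h', show ¬ (m + 1 = n) by omega])
  refine ⟨V, fun x => (hV 0 x).trans (p0 x), fun n x => (hV (n + 1) x).trans (p1 n x), hVi, ?_⟩
  intro x
  refine dil_ext_inner hd fun n y => ?_
  rw [adjoint_inner_left, hV, hin]
  rcases n with _ | n
  · simp [p0, inner_add_right, hin, adjoint_inner_left]
  · simp [p1, inner_add_right, hin]

theorem dil_cuntz (K : Type u) [NormedAddCommGroup K] [InnerProductSpace ℂ K] [CompleteSpace K] :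
    ∃ (L : Type u) (_ : NormedAddCommGroup L) (_ : InnerProductSpace ℂ L) (_ : CompleteSpace L)
      (j : K →ₗᵢ[ℂ] L) (π : (K →L[ℂ] K) →* (L →L[ℂ] L)) (R0 R1 : L →L[ℂ] L),
      (∀ a x, π a (j x) = j (a x)) ∧
      (∀ a, π (adjoint a) = adjoint (π a)) ∧ π 0 = 0 ∧ (∀ a, ‖π a‖ ≤ ‖a‖) ∧
      star R0 * R0 = 1 ∧ star R1 * R1 = 1 ∧ star R0 * R1 = 0 ∧ star R1 * R0 = 0 ∧
      R0 * star R0 + R1 * star R1 = 1 ∧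
      (∀ a, Commute (π a) R0) ∧ (∀ a, Commute (π a) R1) := by
  obtain ⟨L, i1, i2, i3, E, π, hd, hin, hπ, hπs, hπ0, -, hπn⟩ := dil_ampl K
  obtain ⟨R0, hR0, hR0i⟩ := dil_exists_isom hd (fun n => E (2 * n)) (by
    intro i x j y
    simp [hin])
  obtain ⟨R1, hR1, hR1i⟩ := dil_exists_isom hd (fun n => E (2 * n + 1)) (by
    intro i x j y
    simp [hin])
  have h01 : star R0 * R1 = 0 := by
    refine dil_ext_eq hd fun n x => dil_ext_inner hd fun m y => ?_
    change inner ℂ (adjoint R0 (R1 (E n x))) (E m y) = inner ℂ 0 (E m y)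
    rw [adjoint_inner_left, hR0, hR1, hin, inner_zero_left, if_neg (by omega)]
  have h10 : star R1 * R0 = 0 := by
    have := congrArg star h01
    simpa using this
  let j : K →ₗᵢ[ℂ] L := (E 0).isometryOfInner (fun x y => by rw [hin]; simp)
  refine ⟨L, i1, i2, i3, j, π, R0, R1, fun a x => hπ a 0 x, hπs, hπ0, hπn, hR0i, hR1i, h01, h10,
    ?_, ?_, ?_⟩
  · refine dil_ext_eq hd fun n x => ?_
    have e00 : ∀ z, star R0 (R0 z) = z := fun z => congrArg (fun f : L →L[ℂ] L => f z) hR0i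
    have e11 : ∀ z, star R1 (R1 z) = z := fun z => congrArg (fun f : L →L[ℂ] L => f z) hR1i
    have e01 : ∀ z, star R0 (R1 z) = 0 := fun z => congrArg (fun f : L →L[ℂ] L => f z) h01
    have e10 : ∀ z, star R1 (R0 z) = 0 := fun z => congrArg (fun f : L →L[ℂ] L => f z) h10
    change R0 (star R0 (E n x)) + R1 (star R1 (E n x)) = E n x
    rcases Nat.even_or_odd' n with ⟨k, rfl | rfl⟩
    · rw [← hR0 k x, e00, e10, map_zero, add_zero]
    · rw [← hR1 k x, e01, e11, map_zero, zero_add]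
  · intro a
    refine dil_ext_eq hd fun n x => ?_
    change π a (R0 (E n x)) = R0 (π a (E n x))
    rw [hR0, hπ, hπ, hR0]
  · intro a
    refine dil_ext_eq hd fun n x => ?_
    change π a (R1 (E n x)) = R1 (π a (E n x))
    rw [hR1, hπ, hπ, hR1]

/-- Ando's theorem, equivariantly for the commutant. -/
theorem dil_ando {K : Type u} [NormedAddCommGroup K] [InnerProductSpace ℂ K] [CompleteSpace K]
    (S1 S2 : K →L[ℂ] K) (hS1 : ‖S1‖ ≤ 1) (hS2 : ‖S2‖ ≤ 1) (hS : S1 * S2 = S2 * S1) :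
    ∃ (L : Type u) (_ : NormedAddCommGroup L) (_ : InnerProductSpace ℂ L) (_ : CompleteSpace L)
      (j : K →ₗᵢ[ℂ] L) (π : (K →L[ℂ] K) →* (L →L[ℂ] L)) (V1 V2 : L →L[ℂ] L),
      (∀ a x, π a (j x) = j (a x)) ∧
      (∀ a, π (adjoint a) = adjoint (π a)) ∧ π 0 = 0 ∧
      adjoint V1 * V1 = 1 ∧ adjoint V2 * V2 = 1 ∧ V1 * V2 = V2 * V1 ∧
      (∀ x, adjoint V1 (j x) = j (adjoint S1 x)) ∧
      (∀ x, adjoint V2 (j x) = j (adjoint S2 x)) ∧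
      ∀ a, Commute a S1 → Commute (star a) S1 → Commute a S2 → Commute (star a) S2 →
        Commute (π a) V1 ∧ Commute (π a) V2 := by
  obtain ⟨X, _, _, _, j0, ρ, R0, R1, hρj, hρs, hρ0, hρn, h00, h11, h01, h10, hs, c0, c1⟩ :=
    dil_cuntz K
  obtain ⟨U, q, d1, d2, hU, hU', hq, hqq, hd1, hd2, hqd1, hqd2, hUd, hcomm⟩ :=
    dil_alg (ρ S1) (ρ S2) R0 R1 ((hρn _).trans hS1) ((hρn _).trans hS2)
      (by rw [← map_mul, hS, map_mul]) h00 h11 h01 h10 hs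
  obtain ⟨L, i1, i2, i3, E, π, hd, hin, hπ, hπs, hπ0, -, hπn⟩ := dil_ampl X
  have kU : ∀ x, star U * (U * x) = x := fun x => by rw [← mul_assoc, hU, one_mul]
  have kq : ∀ x, q * (q * x) = 0 := fun x => by rw [← mul_assoc, hq, zero_mul]
  have hq' : star q * star q = 0 := by rw [← star_mul, hq, star_zero]
  have kq' : ∀ x, star q * (star q * x) = 0 := fun x => by rw [← mul_assoc, hq', zero_mul]
  have hdq1 : star d1 * q = 0 := by
    have := congrArg star hqd1
    simpa using this
  have hdq2 : star d2 * q = 0 := by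
    have := congrArg star hqd2
    simpa using this
  obtain ⟨V1, hV10, hV1n, hV1, hV1a⟩ := dil_shift E hd hin (ρ S1) (U * d1) (U * q) (U * star q)
    (by simp only [star_mul, mul_assoc, kU, hd1]) (by simp only [star_mul, mul_assoc, kU, hdq1])
    (by simp only [star_mul, star_star, mul_assoc, kU, hqq])
    (by simp only [star_mul, star_star, mul_assoc, kU, hq])
  obtain ⟨V2, hV20, hV2n, hV2, hV2a⟩ := dil_shift E hd hin (ρ S2) d2 (q * star U)
    (star q * star U) hd2 (by rw [← mul_assoc, hdq2, zero_mul])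
    (by
      have : U * (star q * q + q * star q) * star U = 1 := by rw [hqq, mul_one, hU']
      simpa only [star_mul, star_star, mul_assoc, mul_add, add_mul] using this)
    (by simp only [star_mul, star_star, mul_assoc, kq, mul_zero])
  let jE : X →ₗᵢ[ℂ] L := (E 0).isometryOfInner (fun x y => by rw [hin]; simp)
  have hjE : ∀ x, jE x = E 0 x := fun x => rfl
  refine ⟨L, i1, i2, i3, jE.comp j0, π.comp ρ, V1, V2, ?_, ?_, ?_, hV1, hV2, ?_, ?_, ?_, ?_⟩
  · intro a x
    change π (ρ a) (E 0 (j0 x)) = E 0 (j0 (a x))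
    rw [hπ, hρj]
  · intro a
    change π (ρ (adjoint a)) = adjoint (π (ρ a))
    rw [hρs, hπs]
  · change π (ρ 0) = 0
    rw [hρ0, hπ0]
  · refine dil_ext_eq hd fun n x => ?_
    change V1 (V2 (E n x)) = V2 (V1 (E n x))
    have ap : ∀ {f g : X →L[ℂ] X}, f = g → ∀ x, f x = g x := fun h x => by rw [h]
    have a1 : ∀ y, star U (U y) = y := ap hU
    have a2 : ∀ y, q (q y) = 0 := ap hq
    have a3 : ∀ y, star q (star q y) = 0 := ap hq'
    have a4 : ∀ y, star q (q y) + q (star q y) = y := ap hqq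
    have a5 : ∀ y, star q (d1 y) = 0 := ap hqd1
    have a6 : ∀ y, star q (d2 y) = 0 := ap hqd2
    have a7 : ∀ y, U (d1 (ρ S2 y) + q (d2 y)) = d2 (ρ S1 y) + q (d1 y) := ap hUd
    have a8 : ∀ y, U (star U y) = y := ap hU'
    have a9 : ∀ y, ρ S1 (ρ S2 y) = ρ S2 (ρ S1 y) :=
      ap (show ρ S1 * ρ S2 = ρ S2 * ρ S1 by rw [← map_mul, hS, map_mul])
    have v10 : ∀ x, V1 (E 0 x) = E 0 (ρ S1 x) + E 1 (U (d1 x)) := hV10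
    have v1n : ∀ n x, V1 (E (n + 1) x) = E (n + 1) (U (q x)) + E (n + 2) (U (star q x)) := hV1n
    have v2n : ∀ n x, V2 (E (n + 1) x) =
      E (n + 1) (q (star U x)) + E (n + 2) (star q (star U x)) := hV2n
    rcases n with _ | n
    · rw [v10, hV20, map_add, map_add, v10, hV20]
      rw [v1n 0, v2n 0, a1, a5, a6, a9]
      simp only [map_zero, add_zero, zero_add, add_assoc]
      rw [← map_add (E 1), ← map_add (E 1), ← map_add U, a7]
    · rw [v1n, v2n, map_add, map_add, v1n, v1n (n + 1), v2n, v2n (n + 1)]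
      simp only [a1, a2, a3, map_zero, add_zero, zero_add]
      rw [← map_add, ← map_add, a4, a8]
      change _ = E (n + 2) _ + E (n + 2) _
      rw [← map_add, a4]
  · intro x
    change adjoint V1 (E 0 (j0 x)) = E 0 (j0 (adjoint S1 x))
    rw [hV1a, ← hρs, hρj]
  · intro x
    change adjoint V2 (E 0 (j0 x)) = E 0 (j0 (adjoint S2 x))
    rw [hV2a, ← hρs, hρj]
  · intro a h1 h2 h3 h4
    have sρ : star (ρ a) = ρ (star a) := (hρs a).symm
    obtain ⟨cU, cq, cd1, cd2⟩ := hcomm (ρ a) (c0 a) (by rw [sρ]; exact c0 _) (c1 a)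
      (by rw [sρ]; exact c1 _) (h1.map ρ) (by rw [sρ]; exact h2.map ρ) (h3.map ρ)
      (by rw [sρ]; exact h4.map ρ)
    obtain ⟨cU', cq', -, -⟩ := hcomm (ρ (star a)) (c0 _) (by rw [← sρ, star_star]; exact c0 _)
      (c1 _) (by rw [← sρ, star_star]; exact c1 _) (h2.map ρ)
      (by rw [← sρ, star_star]; exact h1.map ρ) (h4.map ρ)
      (by rw [← sρ, star_star]; exact h3.map ρ)
    have cUs : Commute (ρ a) (star U) := by
      have := cU'.star_star
      rwa [← sρ, star_star] at this
    have cqs : Commute (ρ a) (star q) := by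
      have := cq'.star_star
      rwa [← sρ, star_star] at this
    have ap : ∀ {f : X →L[ℂ] X}, Commute (ρ a) f → ∀ x, ρ a (f x) = f (ρ a x) := fun h x =>
      congrArg (fun g : X →L[ℂ] X => g x) h.eq
    constructor
    · refine dil_ext_eq hd fun n x => ?_
      change π (ρ a) (V1 (E n x)) = V1 (π (ρ a) (E n x))
      rcases n with _ | n
      · rw [hV10, hπ, hV10, map_add, hπ, hπ, ap (h1.map ρ), ap (cU.mul_right cd1)]
      · rw [hV1n, hπ, hV1n, map_add, hπ, hπ, ap (cU.mul_right cq), ap (cU.mul_right cqs)]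
    · refine dil_ext_eq hd fun n x => ?_
      change π (ρ a) (V2 (E n x)) = V2 (π (ρ a) (E n x))
      rcases n with _ | n
      · rw [hV20, hπ, hV20, map_add, hπ, hπ, ap (h3.map ρ), ap cd2]
      · rw [hV2n, hπ, hV2n, map_add, hπ, hπ, ap (cq.mul_right cUs), ap (cqs.mul_right cUs)]
/-! ### Right ideals -/

theorem dil_rightSet_prod {M N : Type*} [Monoid M] [Monoid N] (x : M × N) :
    rightSet x = rightSet x.1 ×ˢ rightSet x.2 := by
  ext ⟨a, b⟩
  simp only [rightSet, Set.mem_range, Set.mem_prod, Prod.exists]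
  constructor
  · rintro ⟨c, d, h⟩
    exact ⟨⟨c, congrArg Prod.fst h⟩, ⟨d, congrArg Prod.snd h⟩⟩
  · rintro ⟨⟨c, h⟩, ⟨d, h'⟩⟩
    exact ⟨c, d, Prod.ext h h'⟩

theorem dil_self_mem {M : Type*} [Monoid M] (p : M) : p ∈ rightSet p := ⟨1, mul_one p⟩

theorem dil_rightSet_one {M : Type*} [Monoid M] : rightSet (1 : M) = Set.univ := by
  ext x; simp [rightSet]

theorem dil_lcm {M : Type*} [Monoid M] (hP : IsRightLCMMonoid M) (p q : M) :
    rightSet p ∩ rightSet q = ∅ ∨ ∃ r a b : M, rightSet p ∩ rightSet q = rightSet r ∧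
      r = p * a ∧ r = q * b := by
  rcases hP.2 p q with h | ⟨r, h⟩
  · exact Or.inl h
  · have : r ∈ rightSet p ∩ rightSet q := h ▸ dil_self_mem r
    obtain ⟨⟨a, ha⟩, ⟨b, hb⟩⟩ := this
    exact Or.inr ⟨r, a, b, h, ha.symm, hb.symm⟩

/-- `q (aP ∩ sP) = pP ∩ (qs)P` when `pP ∩ qP = (qa)P`. -/
theorem dil_shift_set {M : Type*} [Monoid M] (hP : IsRightLCMMonoid M) {p q a : M}
    (h : rightSet p ∩ rightSet q = rightSet (q * a)) (s : M) :
    rightSet p ∩ rightSet (q * s) = (fun x => q * x) '' (rightSet a ∩ rightSet s) := by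
  ext y
  constructor
  · rintro ⟨h1, ⟨z, rfl⟩⟩
    have : q * s * z ∈ rightSet p ∩ rightSet q := ⟨h1, ⟨s * z, by simp [mul_assoc]⟩⟩
    rw [h] at this
    obtain ⟨w, hw⟩ := this
    refine ⟨s * z, ⟨⟨w, ?_⟩, ⟨z, rfl⟩⟩, by simp [mul_assoc]⟩
    apply hP.1 q
    simpa [mul_assoc] using hw
  · rintro ⟨_, ⟨⟨w, rfl⟩, ⟨z, hz⟩⟩, rfl⟩
    have : q * (a * w) ∈ rightSet (q * a) := ⟨w, by simp [mul_assoc]⟩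
    rw [← h] at this
    refine ⟨this.1, ⟨z, ?_⟩⟩
    simp only at hz ⊢
    rw [mul_assoc, hz]

theorem dil_image_rightSet {M : Type*} [Monoid M] (q t : M) :
    (fun x => q * x) '' rightSet t = rightSet (q * t) := by
  ext y
  simp [rightSet, mul_assoc]

/-! ### From a `*`-regular dilation -/

theorem dil_extract {P : Type u} [Monoid P] {H : Type u} [NormedAddCommGroup H]
    [InnerProductSpace ℂ H] [CompleteSpace H] (hP : IsRightLCMMonoid P)
    (T : P →* (H →L[ℂ] H)) (S : H →L[ℂ] H)
    (hreg : HasStarRegularDilation (prodRepFun S fun p : P => T p)) :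
    ∃ (K : Type u) (_ : NormedAddCommGroup K) (_ : InnerProductSpace ℂ K) (_ : CompleteSpace K)
      (e : P → H →ₗ[ℂ] K) (W : P → K →L[ℂ] K) (V : K →L[ℂ] K),
      (∀ p q h, W p (e q h) = e (p * q) h) ∧ (∀ p, adjoint (W p) * W p = 1) ∧
      (adjoint V * V = 1) ∧
      (∀ p q h k, rightSet p ∩ rightSet q = ∅ → inner ℂ (e p h) (e q k) = 0) ∧
      (∀ p q a b r h k, rightSet p ∩ rightSet q = rightSet r → r = p * a → r = q * b →
        inner ℂ (e p h) (e q k) = inner ℂ h (T a (adjoint (T b) k))) ∧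
      (∀ p q h k, inner ℂ (V (e p h)) (e q k) = inner ℂ (e p h) (e q (adjoint S k))) := by
  obtain ⟨K, i1, i2, i3, ι, V, hV1, hVm, hVi, hV⟩ := hreg
  have key : ∀ (x y : Multiplicative ℕ × P) (h k : H),
      inner ℂ (V x (ι h)) (V y (ι k)) =
      inner ℂ h ((adjoint ι.toContinuousLinearMap ∘L
          ((adjoint (V x) * V y) ∘L ι.toContinuousLinearMap)) k) := by
    intro x y h k
    change _ = inner ℂ h (adjoint ι.toContinuousLinearMap (adjoint (V x) (V y (ι k))))
    rw [adjoint_inner_right, adjoint_inner_right]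
    rfl
  have g0 : ∀ p q h k, rightSet p ∩ rightSet q = ∅ →
      inner ℂ (V ((1 : Multiplicative ℕ), p) (ι h)) (V (1, q) (ι k)) = 0 := by
    intro p q h k hpq
    rw [key, (hV _ _).1 (by
      rw [dil_rightSet_prod, dil_rightSet_prod, Set.prod_inter_prod]; simp [hpq])]
    simp
  have g1 : ∀ p q a b r h k, rightSet p ∩ rightSet q = rightSet r → r = p * a → r = q * b →
      inner ℂ (V ((1 : Multiplicative ℕ), p) (ι h)) (V (1, q) (ι k)) =
        inner ℂ h (T a (adjoint (T b) k)) := by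
    intro p q a b r h k hr ha hb
    rw [key, (hV _ _).2 (1, r) (1, a) (1, b) (by
      rw [dil_rightSet_prod, dil_rightSet_prod, dil_rightSet_prod (1, r), Set.prod_inter_prod]
      simp [hr]) (by simp [ha]) (by simp [hb])]
    simp [prodRepFun]
  refine ⟨K, i1, i2, i3,
    fun p => (V (1, p) : K →ₗ[ℂ] K) ∘ₗ ι.toLinearMap, fun p => V (1, p),
    V (Multiplicative.ofAdd 1, 1), ?_, fun p => hVi _, hVi _, g0, g1, ?_⟩
  · intro p q h
    change V (1, p) (V (1, q) (ι h)) = V (1, p * q) (ι h)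
    have : ((1 : Multiplicative ℕ), p * q) = (1, p) * (1, q) := by simp
    rw [this, hVm]
    rfl
  · intro p q h k
    change inner ℂ (V (Multiplicative.ofAdd 1, 1) (V (1, p) (ι h))) (V (1, q) (ι k)) =
      inner ℂ (V (1, p) (ι h)) (V (1, q) (ι (adjoint S k)))
    have : V (Multiplicative.ofAdd 1, 1) (V (1, p) (ι h)) =
        V (Multiplicative.ofAdd 1, p) (ι h) := by
      have : ((Multiplicative.ofAdd 1 : Multiplicative ℕ), p) =
        (Multiplicative.ofAdd 1, 1) * (1, p) := by simp
      rw [this, hVm]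
      rfl
    rw [this]
    rcases dil_lcm hP p q with hpq | ⟨r, a, b, hr, ha, hb⟩
    · rw [g0 _ _ _ _ hpq, key, (hV _ _).1 (by
        rw [dil_rightSet_prod, dil_rightSet_prod, Set.prod_inter_prod]; simp [hpq])]
      simp
    · rw [g1 p q a b r _ _ hr ha hb, key, (hV _ _).2 (Multiplicative.ofAdd 1, r) (1, a)
        (Multiplicative.ofAdd 1, b) (by
        rw [dil_rightSet_prod, dil_rightSet_prod, dil_rightSet_prod (Multiplicative.ofAdd 1, r),
          Set.prod_inter_prod]
        simp [hr, dil_rightSet_one]) (by simp [ha]) (by simp [hb])]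
      have : adjoint (S * T b) = adjoint (T b) * adjoint S := by
        rw [← star_eq_adjoint, star_mul]; rfl
      simp [prodRepFun, this]

theorem dil_contr {P : Type*} {H K : Type*} [NormedAddCommGroup H]
    [InnerProductSpace ℂ H] [CompleteSpace H] [NormedAddCommGroup K]
    [InnerProductSpace ℂ K] [CompleteSpace K] (e : P → H →ₗ[ℂ] K) (V : K →L[ℂ] K)
    (hV : adjoint V * V = 1) (S : H →L[ℂ] H)
    (h : ∀ p q h k, inner ℂ (V (e p h)) (e q k) = inner ℂ (e p h) (e q (adjoint S k)))
    (f : P →₀ H) :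
    ‖Finsupp.lsum ℂ (fun p => e p ∘ₗ (adjoint S : H →ₗ[ℂ] H)) f‖ ≤ ‖Finsupp.lsum ℂ e f‖ := by
  have h1 : ∀ g : P →₀ H, inner ℂ (V (Finsupp.lsum ℂ e g)) (Finsupp.lsum ℂ e f) =
      inner ℂ (Finsupp.lsum ℂ e g)
        (Finsupp.lsum ℂ (fun p => e p ∘ₗ (adjoint S : H →ₗ[ℂ] H)) f) := by
    intro g
    simp only [Finsupp.lsum_apply, Finsupp.sum, map_sum, sum_inner, inner_sum, h]
    rfl
  have h2 : Finsupp.lsum ℂ (fun p => e p ∘ₗ (adjoint S : H →ₗ[ℂ] H)) f =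
      Finsupp.lsum ℂ e (f.mapRange (adjoint S) (map_zero _)) := by
    rw [Finsupp.lsum_apply, Finsupp.lsum_apply, Finsupp.sum_mapRange_index (by simp)]
    rfl
  have h3 := h1 (f.mapRange (adjoint S) (map_zero _))
  rw [← h2] at h3
  set z := Finsupp.lsum ℂ (fun p => e p ∘ₗ (adjoint S : H →ₗ[ℂ] H)) f
  have h4 : ‖V z‖ = ‖z‖ := by
    have : inner ℂ (V z) (V z) = inner ℂ z z := by
      rw [← adjoint_inner_right]
      exact congrArg (fun f : K →L[ℂ] K => inner ℂ z (f z)) hV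
    rw [@norm_eq_sqrt_re_inner ℂ, @norm_eq_sqrt_re_inner ℂ _ _ _ _ z, this]
  have h5 : ‖z‖ * ‖z‖ ≤ ‖z‖ * ‖Finsupp.lsum ℂ e f‖ := by
    have := norm_inner_le_norm (𝕜 := ℂ) (V z) (Finsupp.lsum ℂ e f)
    rw [h3, h4, inner_self_eq_norm_sq_to_K] at this
    simpa [pow_two] using this
  rcases (norm_nonneg z).eq_or_lt with h0 | h0
  · rw [← h0]; exact norm_nonneg _
  · exact le_of_mul_le_mul_left h5 h0
/-! ### The minimal space -/

theorem dil_space {P : Type u} [Monoid P] (hP : IsRightLCMMonoid P)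
    {H : Type u} [NormedAddCommGroup H] [InnerProductSpace ℂ H] [CompleteSpace H]
    (T : P →* (H →L[ℂ] H)) (S₁ S₂ : H →L[ℂ] H)
    (hreg₁ : HasStarRegularDilation (prodRepFun S₁ fun p : P => T p))
    (hreg₂ : HasStarRegularDilation (prodRepFun S₂ fun p : P => T p)) :
    ∃ (K : Type u) (_ : NormedAddCommGroup K) (_ : InnerProductSpace ℂ K) (_ : CompleteSpace K)
      (e : P → H →ₗ[ℂ] K) (W : P → K →L[ℂ] K) (C1 C2 : K →L[ℂ] K),
      DenseRange (Finsupp.lsum ℂ e) ∧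
      (∀ p q h, W p (e q h) = e (p * q) h) ∧ (∀ p, adjoint (W p) * W p = 1) ∧
      (∀ p q h k, rightSet p ∩ rightSet q = ∅ → inner ℂ (e p h) (e q k) = 0) ∧
      (∀ p q a b r h k, rightSet p ∩ rightSet q = rightSet r → r = p * a → r = q * b →
        inner ℂ (e p h) (e q k) = inner ℂ h (T a (adjoint (T b) k))) ∧
      ‖C1‖ ≤ 1 ∧ ‖C2‖ ≤ 1 ∧
      (∀ p h, C1 (e p h) = e p (adjoint S₁ h)) ∧ (∀ p h, C2 (e p h) = e p (adjoint S₂ h)) := by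
  obtain ⟨K1, _, _, _, e1, W1, V1, hW1, hWi1, hV1, g10, g11, hVe1⟩ := dil_extract hP T S₁ hreg₁
  obtain ⟨K2, _, _, _, e2, W2, V2, -, -, hV2, g20, g21, hVe2⟩ := dil_extract hP T S₂ hreg₂
  have hg : ∀ p h q k, inner ℂ (e2 p h) (e2 q k) = inner ℂ (e1 p h) (e1 q k) := by
    intro p h q k
    rcases dil_lcm hP p q with hpq | ⟨r, a, b, hr, ha, hb⟩
    · rw [g10 _ _ _ _ hpq, g20 _ _ _ _ hpq]
    · rw [g11 _ _ _ _ _ _ _ hr ha hb, g21 _ _ _ _ _ _ _ hr ha hb]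
  let M : Submodule ℂ K1 := (LinearMap.range (Finsupp.lsum ℂ e1)).topologicalClosure
  have hM : IsClosed (M : Set K1) := Submodule.isClosed_topologicalClosure _
  have : CompleteSpace M := hM.completeSpace_coe
  have hAM : ∀ p h, e1 p h ∈ M := fun p h =>
    Submodule.le_topologicalClosure _ ⟨Finsupp.single p h, by simp⟩
  let e : P → H →ₗ[ℂ] M := fun p => LinearMap.codRestrict M (e1 p) (hAM p)
  have he : ∀ p h q k, inner ℂ (e p h) (e q k) = inner ℂ (e1 p h) (e1 q k) :=
    fun p h q k => rfl
  have hel : ∀ f, ((Finsupp.lsum ℂ e f : M) : K1) = Finsupp.lsum ℂ e1 f := by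
    intro f
    simp only [Finsupp.lsum_apply, Finsupp.sum, Submodule.coe_sum]
    rfl
  have hd : DenseRange (Finsupp.lsum ℂ e) := by
    intro z
    rw [Topology.IsInducing.subtypeVal.closure_eq_preimage_closure_image]
    have := z.2
    change (z : K1) ∈ closure _ at this
    refine closure_mono ?_ this
    rintro _ ⟨f, rfl⟩
    exact ⟨Finsupp.lsum ℂ e f, ⟨f, rfl⟩, hel f⟩
  have hW : ∀ p : P, ∃ A : M →L[ℂ] M, (∀ q h, A (e q h) = e (p * q) h) ∧ adjoint A * A = 1 := by
    intro p
    apply dil_exists_isom hd (fun q => e (p * q))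
    intro q h s k
    rw [he, he, ← hW1, ← hW1, ← adjoint_inner_right]
    exact congrArg (fun f : K1 →L[ℂ] K1 => inner ℂ (e1 q h) (f (e1 s k))) (hWi1 p)
  choose W hWe hWi using hW
  obtain ⟨C1, hC1, hn1⟩ := dil_exists_ext hd
    (fun p => e p ∘ₗ (adjoint S₁ : H →ₗ[ℂ] H)) 1 (fun f => by
      rw [one_mul, ← dil_gram_norm (e := e) (ψ := e1) (fun _ _ _ _ => rfl),
        ← dil_gram_norm (e := fun p => e p ∘ₗ (adjoint S₁ : H →ₗ[ℂ] H))
          (ψ := fun p => e1 p ∘ₗ (adjoint S₁ : H →ₗ[ℂ] H)) (fun _ _ _ _ => rfl)]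
      exact dil_contr e1 V1 hV1 S₁ hVe1 f)
  obtain ⟨C2, hC2, hn2⟩ := dil_exists_ext hd
    (fun p => e p ∘ₗ (adjoint S₂ : H →ₗ[ℂ] H)) 1 (fun f => by
      rw [one_mul, ← dil_gram_norm (e := e) (ψ := e2) (fun _ _ _ _ => hg _ _ _ _),
        ← dil_gram_norm (e := fun p => e p ∘ₗ (adjoint S₂ : H →ₗ[ℂ] H))
          (ψ := fun p => e2 p ∘ₗ (adjoint S₂ : H →ₗ[ℂ] H)) (fun _ _ _ _ => hg _ _ _ _)]
      exact dil_contr e2 V2 hV2 S₂ hVe2 f)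
  exact ⟨M, inferInstance, inferInstance, inferInstance, e, W, C1, C2, hd, hWe, hWi, g10, g11,
    opNorm_le_bound _ zero_le_one hn1, opNorm_le_bound _ zero_le_one hn2, hC1, hC2⟩

theorem dil_step1 {P : Type u} [Monoid P] (hP : IsRightLCMMonoid P)
    {H : Type u} [NormedAddCommGroup H] [InnerProductSpace ℂ H] [CompleteSpace H]
    (T : P →* (H →L[ℂ] H)) (S₁ S₂ : H →L[ℂ] H)
    (hScomm : S₁ * S₂ = S₂ * S₁)
    (hS₁T : ∀ p : P, S₁ * T p = T p * S₁) (hS₂T : ∀ p : P, S₂ * T p = T p * S₂)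
    (hreg₁ : HasStarRegularDilation (prodRepFun S₁ fun p : P => T p))
    (hreg₂ : HasStarRegularDilation (prodRepFun S₂ fun p : P => T p)) :
    ∃ (K : Type u) (_ : NormedAddCommGroup K) (_ : InnerProductSpace ℂ K) (_ : CompleteSpace K)
      (ι : H →ₗᵢ[ℂ] K) (W : P →* (K →L[ℂ] K)) (C1 C2 : K →L[ℂ] K),
      (∀ p, adjoint (W p) * W p = 1) ∧ IsNicaCovariant (fun p : P => W p) ∧
      ‖C1‖ ≤ 1 ∧ ‖C2‖ ≤ 1 ∧ C1 * C2 = C2 * C1 ∧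
      (∀ p, Commute C1 (W p)) ∧ (∀ p, Commute C1 (adjoint (W p))) ∧
      (∀ p, Commute C2 (W p)) ∧ (∀ p, Commute C2 (adjoint (W p))) ∧
      (∀ p h, adjoint (W p) (ι h) = ι (adjoint (T p) h)) ∧
      (∀ h, C1 (ι h) = ι (adjoint S₁ h)) ∧ (∀ h, C2 (ι h) = ι (adjoint S₂ h)) := by
  obtain ⟨K, i1, i2, i3, e, W, C1, C2, hd, hWe, hWi, g0, g1, hn1, hn2, hC1, hC2⟩ :=
    dil_space hP T S₁ S₂ hreg₁ hreg₂
  have hTm : ∀ a b h, adjoint (T (a * b)) h = adjoint (T b) (adjoint (T a) h) := by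
    intro a b h
    have : adjoint (T (a * b)) = adjoint (T b) * adjoint (T a) := by
      rw [map_mul, ← star_eq_adjoint, star_mul]; rfl
    rw [this]; rfl
  have hST : ∀ S : H →L[ℂ] H, (∀ p : P, S * T p = T p * S) → ∀ p h,
      adjoint S (adjoint (T p) h) = adjoint (T p) (adjoint S h) := by
    intro S hS p h
    have := congrArg star (hS p)
    rw [star_mul, star_mul] at this
    exact congrArg (fun f : H →L[ℂ] H => f h) this.symm
  -- the adjoint formula
  have adj0 : ∀ p q h, rightSet p ∩ rightSet q = ∅ → adjoint (W q) (e p h) = 0 := by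
    intro p q h hpq
    apply dil_ext_inner hd
    intro s k
    rw [adjoint_inner_left, hWe, inner_zero_left]
    apply g0
    rw [Set.eq_empty_iff_forall_notMem] at hpq ⊢
    rintro x ⟨hx, ⟨y, rfl⟩⟩
    exact hpq _ ⟨hx, ⟨s * y, by simp [mul_assoc]⟩⟩
  have adj1 : ∀ p q a b r h, rightSet p ∩ rightSet q = rightSet r → r = q * a → r = p * b →
      adjoint (W q) (e p h) = e a (adjoint (T b) h) := by
    intro p q a b r h hr ha hb
    apply dil_ext_inner hd
    intro s k
    rw [adjoint_inner_left, hWe]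
    subst ha
    have hs := dil_shift_set hP hr s
    rcases dil_lcm hP a s with h0 | ⟨t, x, y, ht, hx, hy⟩
    · rw [h0, Set.image_empty] at hs
      rw [g0 _ _ _ _ hs, g0 _ _ _ _ h0]
    · rw [ht, dil_image_rightSet] at hs
      rw [g1 _ _ (b * x) y _ _ _ hs (by rw [hx, ← mul_assoc, hb, mul_assoc])
        (by rw [hy, mul_assoc]), g1 _ _ _ _ _ _ _ ht hx hy, map_mul, adjoint_inner_left]
      rfl
  -- range projections
  have pr0 : ∀ p q h, rightSet q ∩ rightSet p = ∅ → (W q * adjoint (W q)) (e p h) = 0 := by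
    intro p q h hpq
    change W q (adjoint (W q) (e p h)) = 0
    rw [adj0 p q h (by rw [Set.inter_comm, hpq]), map_zero]
  have pr1 : ∀ p q b h, rightSet q ∩ rightSet p = rightSet (p * b) →
      (W q * adjoint (W q)) (e p h) = e (p * b) (adjoint (T b) h) := by
    intro p q b h hr
    have : p * b ∈ rightSet q ∩ rightSet p := hr ▸ dil_self_mem _
    obtain ⟨a, ha⟩ := this.1
    change W q (adjoint (W q) (e p h)) = _
    rw [adj1 p q a b (p * b) h (by rw [Set.inter_comm, hr]) ha.symm rfl, hWe]
    simp only at ha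
    rw [ha]
  have hW1 : W 1 = 1 := by
    apply dil_ext_eq hd
    intro p h
    rw [hWe, one_mul]; rfl
  have hWm : ∀ p q, W (p * q) = W p * W q := by
    intro p q
    apply dil_ext_eq hd
    intro s h
    change _ = W p (W q _)
    rw [hWe, hWe, hWe, mul_assoc]
  have comm : ∀ (S : H →L[ℂ] H) (C : K →L[ℂ] K), (∀ p : P, S * T p = T p * S) →
      (∀ p h, C (e p h) = e p (adjoint S h)) →
      (∀ p, Commute C (W p)) ∧ (∀ p, Commute C (adjoint (W p))) := by
    intro S C hS hC
    constructor
    · intro q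
      apply dil_ext_eq hd
      intro p h
      change C (W q _) = W q (C _)
      rw [hWe, hC, hC, hWe]
    · intro q
      apply dil_ext_eq hd
      intro p h
      change C (adjoint (W q) _) = adjoint (W q) (C _)
      rcases dil_lcm hP p q with h0 | ⟨r, b, a, hr, hb, ha⟩
      · rw [adj0 _ _ _ h0, hC, adj0 _ _ _ h0, map_zero]
      · rw [adj1 _ _ _ _ _ _ hr ha hb, hC, hC, adj1 _ _ _ _ _ _ hr ha hb, hST S hS]
  have lem : ∀ s m : P, ∀ A : Set P, A ∩ rightSet s = rightSet m → ∃ b, m = s * b := by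
    intro s m A h
    have : m ∈ A ∩ rightSet s := h ▸ dil_self_mem _
    obtain ⟨a, ha⟩ := this.2
    exact ⟨a, ha.symm⟩
  have nica : IsNicaCovariant W := by
    intro p q
    constructor
    · intro hpq
      apply dil_ext_eq hd
      intro s h
      change (W p * adjoint (W p)) ((W q * adjoint (W q)) (e s h)) = 0
      rcases hP.2 q s with h0 | ⟨m, hm⟩
      · rw [pr0 _ _ _ h0, map_zero]
      · obtain ⟨b, rfl⟩ := lem _ _ _ hm
        rw [pr1 _ _ _ _ hm, pr0]
        rw [← hm, ← Set.inter_assoc, hpq, Set.empty_inter]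
    · intro r hr
      apply dil_ext_eq hd
      intro s h
      change (W p * adjoint (W p)) ((W q * adjoint (W q)) (e s h)) =
        (W r * adjoint (W r)) (e s h)
      rcases hP.2 q s with h0 | ⟨m, hm⟩
      · rw [pr0 _ _ _ h0, map_zero, pr0]
        rw [← hr, Set.inter_assoc, h0, Set.inter_empty]
      · obtain ⟨b, rfl⟩ := lem _ _ _ hm
        rw [pr1 _ _ _ _ hm]
        have hrs : rightSet r ∩ rightSet s = rightSet p ∩ rightSet (s * b) := by
          rw [← hr, Set.inter_assoc, hm]
        rcases hP.2 p (s * b) with h0 | ⟨n, hn⟩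
        · rw [pr0 _ _ _ h0, pr0 _ _ _ (hrs.trans h0)]
        · obtain ⟨c, rfl⟩ := lem _ _ _ hn
          rw [pr1 _ _ _ _ hn, pr1 s r (b * c) h (by rw [hrs, hn, mul_assoc]), hTm, mul_assoc]
  obtain ⟨c1, c1'⟩ := comm S₁ C1 hS₁T hC1
  obtain ⟨c2, c2'⟩ := comm S₂ C2 hS₂T hC2
  have hin : ∀ h k, inner ℂ (e 1 h) (e 1 k) = inner ℂ h k := by
    intro h k
    rw [g1 1 1 1 1 1 h k (by rw [Set.inter_self]) (by simp) (by simp), map_one,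
      ← star_eq_adjoint, star_one]
    rfl
  let ι : H →ₗᵢ[ℂ] K := (e 1).isometryOfInner hin
  let Wh : P →* (K →L[ℂ] K) := { toFun := W, map_one' := hW1, map_mul' := hWm }
  refine ⟨K, i1, i2, i3, ι, Wh, C1, C2, hWi, nica, hn1, hn2, ?_, c1, c1', c2, c2', ?_,
    hC1 1, hC2 1⟩
  · apply dil_ext_eq hd
    intro p h
    change C1 (C2 _) = C2 (C1 _)
    rw [hC2, hC1, hC1, hC2]
    have := congrArg star hScomm
    rw [star_mul, star_mul] at this
    exact congrArg (fun f : H →L[ℂ] H => e p (f h)) this.symm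
  · intro p h
    change adjoint (W p) (e 1 h) = e 1 (adjoint (T p) h)
    exact adj1 1 p 1 p p h (by rw [dil_rightSet_one, Set.univ_inter]) (by simp) (by simp)
/-! ### Nica covariance of products -/

theorem dil_rightSet_nat (n : Multiplicative ℕ) :
    rightSet n = {k | Multiplicative.toAdd n ≤ Multiplicative.toAdd k} := by
  ext k
  constructor
  · rintro ⟨x, rfl⟩
    change Multiplicative.toAdd n ≤ Multiplicative.toAdd n + Multiplicative.toAdd x
    omega
  · intro h
    refine ⟨Multiplicative.ofAdd (Multiplicative.toAdd k - Multiplicative.toAdd n), ?_⟩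
    change Multiplicative.toAdd n + (Multiplicative.toAdd k - Multiplicative.toAdd n) =
      Multiplicative.toAdd k
    change Multiplicative.toAdd n ≤ Multiplicative.toAdd k at h
    omega

theorem dil_pow_proj {A : Type*} [Ring A] [StarRing A] (V : A) (hV : star V * V = 1) (n m : ℕ) :
    V ^ n * star (V ^ n) * (V ^ m * star (V ^ m)) = V ^ (max n m) * star (V ^ (max n m)) := by
  have h1 : ∀ n : ℕ, star (V ^ n) * V ^ n = 1 := by
    intro n
    induction n with
    | zero => simp
    | succ n ih =>
      rw [pow_succ, star_mul, mul_assoc, ← mul_assoc _ _ V, ih, one_mul, hV]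
  have h2 : ∀ n k : ℕ, V ^ n * star (V ^ n) * V ^ (n + k) = V ^ (n + k) := by
    intro n k
    rw [pow_add, mul_assoc, ← mul_assoc _ _ (V ^ k), h1, one_mul]
  rcases le_total n m with h | h
  · obtain ⟨k, rfl⟩ := Nat.exists_eq_add_of_le h
    rw [max_eq_right h, ← mul_assoc, h2]
  · obtain ⟨k, rfl⟩ := Nat.exists_eq_add_of_le h
    rw [max_eq_left h]
    have := congrArg star (h2 m k)
    rw [star_mul, star_mul, star_star] at this
    rw [mul_assoc, this]

theorem dil_nica_prod {P : Type*} [Monoid P] {L : Type*} [NormedAddCommGroup L]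
    [InnerProductSpace ℂ L] [CompleteSpace L] (V : L →L[ℂ] L) (W : P → (L →L[ℂ] L))
    (hV : adjoint V * V = 1) (hW : IsNicaCovariant W) (h1 : ∀ p, Commute V (W p))
    (h2 : ∀ p, Commute V (adjoint (W p))) : IsNicaCovariant (prodRepFun V W) := by
  have hE : ∀ p, Commute V (W p * adjoint (W p)) := fun p => (h1 p).mul_right (h2 p)
  have hE' : ∀ p, Commute (star V) (W p * adjoint (W p)) := by
    intro p
    have := (hE p).star_star
    rw [star_mul, ← star_eq_adjoint, star_star] at this
    exact this
  have hx : ∀ x : Multiplicative ℕ × P, prodRepFun V W x * adjoint (prodRepFun V W x) =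
      V ^ (Multiplicative.toAdd x.1) * star (V ^ (Multiplicative.toAdd x.1)) *
        (W x.2 * adjoint (W x.2)) := by
    intro x
    have : Commute (star (V ^ (Multiplicative.toAdd x.1))) (W x.2 * adjoint (W x.2)) := by
      rw [star_pow]; exact (hE' x.2).pow_left _
    rw [mul_assoc _ (star _), this.eq, ← star_eq_adjoint, ← star_eq_adjoint, prodRepFun, star_mul]
    simp only [mul_assoc]
  have hxy : ∀ x y : Multiplicative ℕ × P,
      prodRepFun V W x * adjoint (prodRepFun V W x) *
        (prodRepFun V W y * adjoint (prodRepFun V W y)) =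
      V ^ (max (Multiplicative.toAdd x.1) (Multiplicative.toAdd y.1)) *
        star (V ^ (max (Multiplicative.toAdd x.1) (Multiplicative.toAdd y.1))) *
        (W x.2 * adjoint (W x.2) * (W y.2 * adjoint (W y.2))) := by
    intro x y
    rw [hx, hx, ← dil_pow_proj V hV]
    have : Commute (W x.2 * adjoint (W x.2))
        (V ^ (Multiplicative.toAdd y.1) * star (V ^ (Multiplicative.toAdd y.1))) := by
      rw [star_pow]
      exact ((hE x.2).pow_left _).symm.mul_right ((hE' x.2).pow_left _).symm
    rw [mul_assoc, ← mul_assoc (W x.2 * adjoint (W x.2)), this.eq]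
    simp only [mul_assoc]
  have hmax : ∀ a b : Multiplicative ℕ, rightSet a ∩ rightSet b =
      rightSet (Multiplicative.ofAdd (max (Multiplicative.toAdd a) (Multiplicative.toAdd b))) := by
    intro a b
    rw [dil_rightSet_nat, dil_rightSet_nat, dil_rightSet_nat]
    ext k
    simp
  intro x y
  constructor
  · intro h
    rw [dil_rightSet_prod, dil_rightSet_prod, Set.prod_inter_prod, hmax,
      Set.prod_eq_empty_iff] at h
    rcases h with h | h
    · exact absurd h (Set.Nonempty.ne_empty ⟨_, dil_self_mem _⟩)
    · rw [hxy, (hW _ _).1 h, mul_zero]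
  · intro r h
    rw [dil_rightSet_prod, dil_rightSet_prod, dil_rightSet_prod r, Set.prod_inter_prod, hmax] at h
    have hne : (rightSet r.1 ×ˢ rightSet r.2).Nonempty :=
      ⟨(r.1, r.2), dil_self_mem _, dil_self_mem _⟩
    rw [Set.prod_eq_prod_iff_of_nonempty (h ▸ hne)] at h
    obtain ⟨ha, hb⟩ := h
    have hr1 : Multiplicative.toAdd r.1 =
        max (Multiplicative.toAdd x.1) (Multiplicative.toAdd y.1) := by
      rw [dil_rightSet_nat, dil_rightSet_nat] at ha
      apply le_antisymm
      · have : Multiplicative.ofAdd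
          (max (Multiplicative.toAdd x.1) (Multiplicative.toAdd y.1)) ∈
            {k | Multiplicative.toAdd r.1 ≤ Multiplicative.toAdd k} := by
          rw [← ha]; exact le_refl (α := ℕ) _
        exact this
      · have : r.1 ∈ {k | Multiplicative.toAdd (Multiplicative.ofAdd
          (max (Multiplicative.toAdd x.1) (Multiplicative.toAdd y.1))) ≤
            Multiplicative.toAdd k} := by
          rw [ha]; exact le_refl (α := ℕ) _
        exact this
    rw [hxy, hx, (hW _ _).2 _ hb, hr1]

theorem dil_compress {H L : Type*} [NormedAddCommGroup H] [InnerProductSpace ℂ H]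
    [CompleteSpace H] [NormedAddCommGroup L] [InnerProductSpace ℂ L] [CompleteSpace L]
    (ι : H →ₗᵢ[ℂ] L) (X : L →L[ℂ] L) (Y : H →L[ℂ] H)
    (h : ∀ x, adjoint X (ι x) = ι (adjoint Y x)) :
    adjoint ι.toContinuousLinearMap ∘L (X ∘L ι.toContinuousLinearMap) = Y := by
  ext x
  apply ext_inner_right ℂ
  intro y
  change inner ℂ (adjoint ι.toContinuousLinearMap (X (ι x))) y = _
  rw [adjoint_inner_left]
  change inner ℂ (X (ι x)) (ι y) = _
  rw [← adjoint_inner_right, h, ι.inner_map_map, adjoint_inner_right]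

theorem dil_co_mul {H L : Type*} [NormedAddCommGroup H] [InnerProductSpace ℂ H]
    [CompleteSpace H] [NormedAddCommGroup L] [InnerProductSpace ℂ L] [CompleteSpace L]
    (ι : H →ₗᵢ[ℂ] L) (X X' : L →L[ℂ] L) (Y Y' : H →L[ℂ] H)
    (h : ∀ x, adjoint X (ι x) = ι (adjoint Y x)) (h' : ∀ x, adjoint X' (ι x) = ι (adjoint Y' x))
    (x : H) : adjoint (X * X') (ι x) = ι (adjoint (Y * Y') x) := by
  rw [← star_eq_adjoint, ← star_eq_adjoint, star_mul, star_mul]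
  change adjoint X' (adjoint X (ι x)) = ι (adjoint Y' (adjoint Y x))
  rw [h, h']

theorem dil_co_pow {H L : Type*} [NormedAddCommGroup H] [InnerProductSpace ℂ H]
    [CompleteSpace H] [NormedAddCommGroup L] [InnerProductSpace ℂ L] [CompleteSpace L]
    (ι : H →ₗᵢ[ℂ] L) (X : L →L[ℂ] L) (Y : H →L[ℂ] H)
    (h : ∀ x, adjoint X (ι x) = ι (adjoint Y x)) (n : ℕ) :
    ∀ x, adjoint (X ^ n) (ι x) = ι (adjoint (Y ^ n) x) := by
  induction n with
  | zero =>
    intro x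
    rw [pow_zero, pow_zero, ← star_eq_adjoint, ← star_eq_adjoint, star_one, star_one]
    rfl
  | succ n ih =>
    rw [pow_succ, pow_succ]
    exact dil_co_mul ι _ _ _ _ ih h

/-- Ando-type dilation on `ℕ² × P` for a right LCM monoid `P`: if `S₁, S₂` are commuting
contractions commuting with a contractive representation `T` of `P`, and for each `i = 1, 2`
the representation `Sᵢ × T` of `ℕ × P` has a `*`-regular dilation, then there exist commuting
isometries `V₁, V₂` and an isometric Nica-covariant representation `W` of `P` on some
`L ⊇ H` such that `(V₁ × V₂) × W` is an isometric dilation of `(S₁ × S₂) × T`, and such that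
`Vᵢ × W` is an isometric Nica-covariant co-extension of `Sᵢ × T` for `i = 1, 2`. -/
theorem ando_type_dilation_prod {P : Type u} [Monoid P] (hP : IsRightLCMMonoid P)
    {H : Type u} [NormedAddCommGroup H] [InnerProductSpace ℂ H] [CompleteSpace H]
    (T : P →* (H →L[ℂ] H)) (hTcontr : ∀ p : P, ‖T p‖ ≤ 1)
    (S₁ S₂ : H →L[ℂ] H) (hS₁ : ‖S₁‖ ≤ 1) (hS₂ : ‖S₂‖ ≤ 1)
    (hScomm : S₁ * S₂ = S₂ * S₁)
    (hS₁T : ∀ p : P, S₁ * T p = T p * S₁) (hS₂T : ∀ p : P, S₂ * T p = T p * S₂)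
    (hreg₁ : HasStarRegularDilation (prodRepFun S₁ fun p : P => T p))
    (hreg₂ : HasStarRegularDilation (prodRepFun S₂ fun p : P => T p)) :
    ∃ (L : Type u) (_ : NormedAddCommGroup L) (_ : InnerProductSpace ℂ L) (_ : CompleteSpace L)
      (ι : H →ₗᵢ[ℂ] L) (V₁ V₂ : L →L[ℂ] L) (W : P →* (L →L[ℂ] L)),
      -- V₁, V₂ are commuting isometries and W is an isometric Nica-covariant representation
      adjoint V₁ * V₁ = 1 ∧ adjoint V₂ * V₂ = 1 ∧ V₁ * V₂ = V₂ * V₁ ∧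
      (∀ p : P, adjoint (W p) * W p = 1) ∧ IsNicaCovariant (fun p : P => W p) ∧
      -- (1) V₁, V₂ commute with W
      (∀ p : P, V₁ * W p = W p * V₁) ∧ (∀ p : P, V₂ * W p = W p * V₂) ∧
      -- (2) (V₁ × V₂) × W is an isometric dilation of (S₁ × S₂) × T
      (∀ (n m : ℕ) (p : P),
        adjoint ι.toContinuousLinearMap ∘L
            ((V₁ ^ n * V₂ ^ m * W p) ∘L ι.toContinuousLinearMap) =
          S₁ ^ n * S₂ ^ m * T p) ∧
      -- (3) Vᵢ × W is an isometric Nica-covariant co-extension of Sᵢ × T for i = 1, 2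
      IsNicaCovariant (prodRepFun V₁ fun p : P => W p) ∧
      IsNicaCovariant (prodRepFun V₂ fun p : P => W p) ∧
      (∀ (x : Multiplicative ℕ × P) (h : H),
        adjoint (prodRepFun V₁ (fun p : P => W p) x) (ι h) ∈ Set.range ι) ∧
      (∀ (x : Multiplicative ℕ × P) (h : H),
        adjoint (prodRepFun V₂ (fun p : P => W p) x) (ι h) ∈ Set.range ι) ∧
      (∀ x : Multiplicative ℕ × P,
        adjoint ι.toContinuousLinearMap ∘L
            (prodRepFun V₁ (fun p : P => W p) x ∘L ι.toContinuousLinearMap) =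
          prodRepFun S₁ (fun p : P => T p) x) ∧
      (∀ x : Multiplicative ℕ × P,
        adjoint ι.toContinuousLinearMap ∘L
            (prodRepFun V₂ (fun p : P => W p) x ∘L ι.toContinuousLinearMap) =
          prodRepFun S₂ (fun p : P => T p) x) := by
  obtain ⟨K, _, _, _, ι, W, C1, C2, hWi, hN, hn1, hn2, hC, c1, c1', c2, c2', hWι, hC1, hC2⟩ :=
    dil_step1 hP T S₁ S₂ hScomm hS₁T hS₂T hreg₁ hreg₂
  obtain ⟨L, i1, i2, i3, j, π, V1, V2, hπj, hπs, hπ0, hV1, hV2, hV, hVj1, hVj2, hcomm⟩ :=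
    dil_ando (adjoint C1) (adjoint C2)
      ((LinearIsometryEquiv.norm_map _ _).trans_le hn1)
      ((LinearIsometryEquiv.norm_map _ _).trans_le hn2)
      (by
        have := congrArg star hC
        rw [star_mul, star_mul] at this
        exact this.symm)
  have hs : ∀ p, adjoint (adjoint (W p)) = W p := fun p => adjoint_adjoint _
  have d1 : ∀ p, Commute (W p) (adjoint C1) := fun p => by
    have := (c1' p).star_star.symm
    rwa [star_eq_adjoint, star_eq_adjoint, hs] at this
  have d1' : ∀ p, Commute (adjoint (W p)) (adjoint C1) := fun p => (c1 p).star_star.symm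
  have d2 : ∀ p, Commute (W p) (adjoint C2) := fun p => by
    have := (c2' p).star_star.symm
    rwa [star_eq_adjoint, star_eq_adjoint, hs] at this
  have d2' : ∀ p, Commute (adjoint (W p)) (adjoint C2) := fun p => (c2 p).star_star.symm
  have f := fun p => hcomm (W p) (d1 p) (d1' p) (d2 p) (d2' p)
  have f' := fun p => hcomm (adjoint (W p)) (d1' p)
    (by rw [star_eq_adjoint, hs]; exact d1 p) (d2' p) (by rw [star_eq_adjoint, hs]; exact d2 p)
  let WL : P →* (L →L[ℂ] L) := π.comp W
  have hWL : ∀ p, WL p = π (W p) := fun p => rfl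
  have e1 : ∀ p, Commute V1 (WL p) := fun p => (f p).1.symm
  have e2 : ∀ p, Commute V2 (WL p) := fun p => (f p).2.symm
  have e1' : ∀ p, Commute V1 (adjoint (WL p)) := fun p => by
    rw [hWL, ← hπs]; exact (f' p).1.symm
  have e2' : ∀ p, Commute V2 (adjoint (WL p)) := fun p => by
    rw [hWL, ← hπs]; exact (f' p).2.symm
  have hNL : IsNicaCovariant (fun p : P => WL p) := by
    intro p q
    constructor
    · intro h
      simp only [hWL, ← hπs, ← map_mul]
      rw [(hN p q).1 h, hπ0]
    · intro r h
      simp only [hWL, ← hπs, ← map_mul]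
      rw [(hN p q).2 r h]
  let ιL : H →ₗᵢ[ℂ] L := j.comp ι
  have k1 : ∀ x, adjoint V1 (ιL x) = ιL (adjoint S₁ x) := by
    intro x
    change adjoint V1 (j (ι x)) = j (ι _)
    rw [hVj1, adjoint_adjoint, hC1]
  have k2 : ∀ x, adjoint V2 (ιL x) = ιL (adjoint S₂ x) := by
    intro x
    change adjoint V2 (j (ι x)) = j (ι _)
    rw [hVj2, adjoint_adjoint, hC2]
  have kW : ∀ p x, adjoint (WL p) (ιL x) = ιL (adjoint (T p) x) := by
    intro p x
    change adjoint (π (W p)) (j (ι x)) = j (ι _)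
    rw [← hπs, hπj, hWι]
  have m1 : ∀ (x : Multiplicative ℕ × P) (h : H),
      adjoint (prodRepFun V1 (fun p : P => WL p) x) (ιL h) =
        ιL (adjoint (prodRepFun S₁ (fun p : P => T p) x) h) := fun x =>
    dil_co_mul ιL _ _ _ _ (dil_co_pow ιL _ _ k1 _) (kW _)
  have m2 : ∀ (x : Multiplicative ℕ × P) (h : H),
      adjoint (prodRepFun V2 (fun p : P => WL p) x) (ιL h) =
        ιL (adjoint (prodRepFun S₂ (fun p : P => T p) x) h) := fun x =>
    dil_co_mul ιL _ _ _ _ (dil_co_pow ιL _ _ k2 _) (kW _)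
  refine ⟨L, i1, i2, i3, ιL, V1, V2, WL, hV1, hV2, hV, ?_, hNL, fun p => (e1 p).eq,
    fun p => (e2 p).eq, ?_, dil_nica_prod V1 _ hV1 hNL e1 e1', dil_nica_prod V2 _ hV2 hNL e2 e2',
    fun x h => ⟨_, (m1 x h).symm⟩, fun x h => ⟨_, (m2 x h).symm⟩,
    fun x => dil_compress ιL _ _ (m1 x), fun x => dil_compress ιL _ _ (m2 x)⟩
  · intro p
    rw [hWL, ← hπs, ← map_mul, hWi, map_one]
  · intro n m p
    exact dil_compress ιL _ _ (dil_co_mul ιL _ _ _ _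
      (dil_co_mul ιL _ _ _ _ (dil_co_pow ιL _ _ k1 n) (dil_co_pow ιL _ _ k2 m)) (kW p))
end
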